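/- Let n ≥ 1, 0 < ε ≤ 1, 0 ≤ ρ ≤ 1 and 1 ≤ p < ∞. Let ω : [0,∞) → [0,∞) be non-decreasing and bounded with ∫₀¹ ω(t) t⁻¹ dt < ∞. Let σ : 𝕋ⁿ × ℝⁿ → ℂ be a smooth symbol for which there is C > 0 such that |∂_ξ^α ∂_x^β σ(x,ξ)| ≤ C ω(⟨ξ⟩^{−ε}) ⟨ξ⟩^{−(n/2)(1−ρ) − ρ|α|} for all (x,ξ) ∈ 𝕋ⁿ × ℝⁿ and all multi-indices α, β with |α| ≤ [n/2]+1 and |β| ≤ [n/p]+1. Then the periodic pseudo-differential operator σ(x,D)f(x) = Σ_{ξ∈ℤⁿ} e^{2πi⟨x,ξ⟩} σ(x,ξ) f̂(ξ) is a bounded linear operator on L^p(𝕋ⁿ). -/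

import Mathlib

open MeasureTheory Real ENNReal

noncomputable section

/-- Partial derivative of a complex-valued function on `ℝⁿ` in the `j`-th coordinate
direction. -/
def pd {n : ℕ} (j : Fin n) (f : (Fin n → ℝ) → ℂ) : (Fin n → ℝ) → ℂ :=
  fun x => fderiv ℝ f x (Pi.single j 1)

/-- The canonical list of directions associated to a multi-index `β ∈ ℕⁿ`. -/
def mIdxList {n : ℕ} (β : Fin n → ℕ) : List (Fin n) :=
  (List.finRange n).flatMap fun j => List.replicate (β j) j

/-- Iterated partial derivative `∂^β` associated to a multi-index `β`. -/
def pdM {n : ℕ} (β : Fin n → ℕ) (f : (Fin n → ℝ) → ℂ) : (Fin n → ℝ) → ℂ :=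
  (mIdxList β).foldr pd f

/-- Forward difference operator in the `j`-th direction on functions of `ξ ∈ ℤⁿ`. -/
def dd {n : ℕ} (j : Fin n) (g : (Fin n → ℤ) → ℂ) : (Fin n → ℤ) → ℂ :=
  fun ξ => g (ξ + Pi.single j 1) - g ξ

/-- Iterated difference operator `Δ_ξ^α` associated to a multi-index `α`. -/
def ddM {n : ℕ} (α : Fin n → ℕ) (g : (Fin n → ℤ) → ℂ) : (Fin n → ℤ) → ℂ :=
  (mIdxList α).foldr dd g

/-- Japanese bracket `⟨ξ⟩ = (1+|ξ|²)^{1/2}` of a lattice point `ξ ∈ ℤⁿ`. -/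
def jb {n : ℕ} (ξ : Fin n → ℤ) : ℝ := Real.sqrt (1 + ∑ j, ((ξ j : ℝ)) ^ 2)

/-- Japanese bracket `⟨ξ⟩ = (1+|ξ|²)^{1/2}` of a vector `ξ ∈ ℝⁿ`. -/
def jbR {n : ℕ} (ξ : Fin n → ℝ) : ℝ := Real.sqrt (1 + ∑ j, (ξ j) ^ 2)

/-- The canonical embedding `ℤⁿ → ℝⁿ`. -/
def castZ {n : ℕ} (ξ : Fin n → ℤ) : Fin n → ℝ := fun j => (ξ j : ℝ)

/-- The fundamental domain `[0,1)ⁿ` of the torus `𝕋ⁿ = ℝⁿ/ℤⁿ`. -/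
def cube (n : ℕ) : Set (Fin n → ℝ) := Set.univ.pi fun _ => Set.Ico (0 : ℝ) 1

/-- The normalized Lebesgue measure of the torus `𝕋ⁿ`, realized as the Lebesgue measure
on `ℝⁿ` restricted to the fundamental domain `[0,1)ⁿ`. -/
def μT (n : ℕ) : Measure (Fin n → ℝ) := volume.restrict (cube n)

/-- `1`-periodicity of a function on `ℝⁿ` (i.e. the function descends to `𝕋ⁿ`). -/
def Per {n : ℕ} (f : (Fin n → ℝ) → ℂ) : Prop :=
  ∀ (x : Fin n → ℝ) (v : Fin n → ℤ), f (x + fun j => (v j : ℝ)) = f x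

/-- The character `e^{2πi⟨x,ξ⟩}`. -/
def eChar {n : ℕ} (x : Fin n → ℝ) (ξ : Fin n → ℤ) : ℂ :=
  Complex.exp (2 * (π : ℂ) * Complex.I * ∑ j, (x j : ℂ) * (ξ j : ℂ))

/-- Fourier coefficient `f̂(ξ) = ∫_{𝕋ⁿ} e^{-2πi⟨x,ξ⟩} f(x) dx` of a function on `𝕋ⁿ`. -/
def fc {n : ℕ} (f : (Fin n → ℝ) → ℂ) (ξ : Fin n → ℤ) : ℂ :=
  ∫ x, Complex.exp (-(2 * (π : ℂ) * Complex.I) * ∑ j, (x j : ℂ) * (ξ j : ℂ)) * f x ∂(μT n)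

/-- Periodic pseudo-differential operator
    `σ(x,D)f(x) = Σ_{ξ ∈ ℤⁿ} e^{2πi⟨x,ξ⟩} σ(x,ξ) f̂(ξ)`
with symbol `σ` on `𝕋ⁿ × ℤⁿ`. -/
def Op {n : ℕ} (σ : (Fin n → ℝ) → (Fin n → ℤ) → ℂ) (f : (Fin n → ℝ) → ℂ) :
    (Fin n → ℝ) → ℂ :=
  fun x => ∑' ξ : Fin n → ℤ, eChar x ξ * σ x ξ * fc f ξ

/-- The `L^p(𝕋ⁿ)` norm, for a real exponent `p`. -/
def lpT (n : ℕ) (p : ℝ) (g : (Fin n → ℝ) → ℂ) : ℝ :=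
  (∫ x, ‖g x‖ ^ p ∂(μT n)) ^ (1 / p)

/-- `∂_x^β Δ_ξ^α σ(x,ξ)` for a symbol `σ` on `𝕋ⁿ × ℤⁿ` (difference operator applied first,
then the derivatives in `x`). -/
def symbDxD {n : ℕ} (β α : Fin n → ℕ) (σ : (Fin n → ℝ) → (Fin n → ℤ) → ℂ)
    (x : Fin n → ℝ) (ξ : Fin n → ℤ) : ℂ :=
  pdM β (fun x' => ddM α (σ x') ξ) x

/-- `Δ_ξ^α ∂_x^β σ(x,ξ)` for a symbol `σ` on `𝕋ⁿ × ℤⁿ` (derivatives in `x` applied first,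
then the difference operator in `ξ`). -/
def symbDDx {n : ℕ} (α β : Fin n → ℕ) (σ : (Fin n → ℝ) → (Fin n → ℤ) → ℂ)
    (x : Fin n → ℝ) (ξ : Fin n → ℤ) : ℂ :=
  ddM α (fun ξ' => pdM β (fun x' => σ x' ξ') x) ξ

/-- `∂_ξ^α ∂_x^β σ(x,ξ)` for a symbol `σ` on `𝕋ⁿ × ℝⁿ` (derivatives in `x` applied first,
then the derivatives in `ξ`). -/
def symbDξDx {n : ℕ} (α β : Fin n → ℕ) (σ : (Fin n → ℝ) → (Fin n → ℝ) → ℂ)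
    (x ξ : Fin n → ℝ) : ℂ :=
  pdM α (fun ξ' => pdM β (fun x' => σ x' ξ') x) ξ

/-- `∂_x^β ∂_ξ^α σ(x,ξ)` for a symbol `σ` on `𝕋ⁿ × ℝⁿ` (derivatives in `ξ` applied first,
then the derivatives in `x`). -/
def symbDxDξ {n : ℕ} (β α : Fin n → ℕ) (σ : (Fin n → ℝ) → (Fin n → ℝ) → ℂ)
    (x ξ : Fin n → ℝ) : ℂ :=
  pdM β (fun x' => pdM α (σ x') ξ) x

/-- The Euclidean Fourier transform `û(ξ) = ∫_{ℝⁿ} e^{-2πi⟨x,ξ⟩} u(x) dx`. -/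
def FT {n : ℕ} (u : (Fin n → ℝ) → ℂ) (ξ : Fin n → ℝ) : ℂ :=
  ∫ x, Complex.exp (-(2 * (π : ℂ) * Complex.I) * ∑ j, (x j : ℂ) * (ξ j : ℂ)) * u x

/-- Pseudo-differential operator on `ℝⁿ`:
`T_σ u(x) = ∫_{ℝⁿ} e^{2πi⟨x,ξ⟩} σ(x,ξ) û(ξ) dξ`. -/
def OpR {n : ℕ} (σ : (Fin n → ℝ) → (Fin n → ℝ) → ℂ) (u : (Fin n → ℝ) → ℂ) :
    (Fin n → ℝ) → ℂ :=
  fun x => ∫ ξ, Complex.exp (2 * (π : ℂ) * Complex.I * ∑ j, (x j : ℂ) * (ξ j : ℂ)) * σ x ξ * FT u ξ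

/-- Periodic amplitude operator
`a(x,y,D)u(x) = ∫_{𝕋ⁿ} ∫_{ℝⁿ} e^{2πi⟨x-y,ξ⟩} a(x,y,ξ) u(y) dξ dy`. -/
def OpAmp {n : ℕ} (a : (Fin n → ℝ) → (Fin n → ℝ) → (Fin n → ℝ) → ℂ)
    (u : (Fin n → ℝ) → ℂ) : (Fin n → ℝ) → ℂ :=
  fun x => ∫ y,
    (∫ ξ, Complex.exp (2 * (π : ℂ) * Complex.I * ∑ j, ((x j : ℂ) - (y j : ℂ)) * (ξ j : ℂ)) *
        a x y ξ) * u y ∂(μT n)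

/-- The `L^p(ℝⁿ)` norm, for a real exponent `p`. -/
def lpR (n : ℕ) (p : ℝ) (g : (Fin n → ℝ) → ℂ) : ℝ :=
  (∫ x, ‖g x‖ ^ p) ^ (1 / p)

/-! ### Iterated partial derivatives -/

theorem contDiff_pd {n : ℕ} (j : Fin n) {f : (Fin n → ℝ) → ℂ} (hf : ContDiff ℝ (⊤ : ℕ∞) f) :
    ContDiff ℝ (⊤ : ℕ∞) (pd j f) :=
  (hf.fderiv_right (m := ((⊤ : ℕ∞) : WithTop ℕ∞)) (by simp)).clm_apply contDiff_const

theorem contDiff_foldr_pd {n : ℕ} (l : List (Fin n)) {f : (Fin n → ℝ) → ℂ}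
    (hf : ContDiff ℝ (⊤ : ℕ∞) f) : ContDiff ℝ (⊤ : ℕ∞) (l.foldr pd f) := by
  induction l with
  | nil => exact hf
  | cons j l ih => exact contDiff_pd j ih

theorem pd_comm {n : ℕ} (i j : Fin n) {f : (Fin n → ℝ) → ℂ} (hf : ContDiff ℝ (⊤ : ℕ∞) f) :
    pd i (pd j f) = pd j (pd i f) := by
  have hd : Differentiable ℝ (fderiv ℝ f) :=
    (hf.fderiv_right (m := ((⊤ : ℕ∞) : WithTop ℕ∞)) (by simp)).differentiable (by simp)
  have key : ∀ (i j : Fin n) (x : Fin n → ℝ),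
      pd i (pd j f) x = fderiv ℝ (fderiv ℝ f) x (Pi.single i 1) (Pi.single j 1) := by
    intro i j x
    change fderiv ℝ (fun y => fderiv ℝ f y (Pi.single j 1)) x (Pi.single i 1) = _
    rw [fderiv_clm_apply hd.differentiableAt (differentiableAt_const _)]
    simp
  funext x
  rw [key, key]
  exact (hf.contDiffAt.isSymmSndFDerivAt
    (by
      rw [minSmoothness_of_isRCLikeNormedField]
      exact WithTop.coe_le_coe.2 (le_top (a := (2 : ℕ∞))))) _ _

theorem foldr_pd_perm {n : ℕ} {l l' : List (Fin n)} (h : l.Perm l') {f : (Fin n → ℝ) → ℂ}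
    (hf : ContDiff ℝ (⊤ : ℕ∞) f) : l.foldr pd f = l'.foldr pd f := by
  induction h with
  | nil => rfl
  | cons j _ ih => exact congrArg (pd j) ih
  | swap i j l => exact pd_comm _ _ (contDiff_foldr_pd l hf)
  | trans _ _ ih₁ ih₂ => exact ih₁.trans ih₂

theorem count_mIdxList {n : ℕ} (β : Fin n → ℕ) (i : Fin n) : (mIdxList β).count i = β i := by
  rw [mIdxList, List.count_flatMap]
  simp only [Function.comp_def, List.count_replicate]
  rw [← Fin.sum_univ_def]
  simp

theorem foldr_pd_eq_pdM {n : ℕ} (l : List (Fin n)) {f : (Fin n → ℝ) → ℂ}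
    (hf : ContDiff ℝ (⊤ : ℕ∞) f) : l.foldr pd f = pdM (fun j => l.count j) f :=
  foldr_pd_perm (List.perm_iff_count.2 fun i => by rw [count_mIdxList]) hf

theorem sum_count_eq_length {n : ℕ} (l : List (Fin n)) : ∑ j, l.count j = l.length := by
  induction l with
  | nil => simp
  | cons a l ih => simp [List.count_cons, Finset.sum_add_distrib, ih]

theorem pdM_single {n : ℕ} (j : Fin n) (a : ℕ) {f : (Fin n → ℝ) → ℂ}
    (hf : ContDiff ℝ (⊤ : ℕ∞) f) : pdM (Pi.single j a) f = (pd j)^[a] f := by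
  have h : (List.replicate a j).foldr pd f = (pd j)^[a] f := by
    induction a with
    | zero => rfl
    | succ a ih => rw [List.replicate_succ, List.foldr_cons, ih, Function.iterate_succ_apply']
  rw [← h, foldr_pd_eq_pdM _ hf]
  congr 1
  funext i
  by_cases h : i = j
  · subst h; simp
  · simp [List.count_replicate, h, Ne.symm h]

theorem contDiff_iterate_pd {n : ℕ} (j : Fin n) (a : ℕ) {f : (Fin n → ℝ) → ℂ}
    (hf : ContDiff ℝ (⊤ : ℕ∞) f) : ContDiff ℝ (⊤ : ℕ∞) ((pd j)^[a] f) := by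
  induction a generalizing f with
  | zero => exact hf
  | succ a ih => exact ih (contDiff_pd j hf)

theorem pd_sum_mul {n : ℕ} {ι : Type*} (S : Finset ι) (c : ι → ℂ) (j : Fin n)
    {f : ι → (Fin n → ℝ) → ℂ} (hf : ∀ i, ContDiff ℝ (⊤ : ℕ∞) (f i)) :
    pd j (fun x => ∑ i ∈ S, c i * f i x) = fun x => ∑ i ∈ S, c i * pd j (f i) x := by
  funext x
  have hd : ∀ i, DifferentiableAt ℝ (f i) x := fun i =>
    ((hf i).differentiable (by simp)).differentiableAt
  simp only [pd]
  rw [fderiv_fun_sum fun i _ => (hd i).const_mul (c i)]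
  simp [fderiv_const_mul (hd _)]

theorem foldr_pd_sum_mul {n : ℕ} {ι : Type*} (S : Finset ι) (c : ι → ℂ) (l : List (Fin n))
    {f : ι → (Fin n → ℝ) → ℂ} (hf : ∀ i, ContDiff ℝ (⊤ : ℕ∞) (f i)) :
    l.foldr pd (fun x => ∑ i ∈ S, c i * f i x) = fun x => ∑ i ∈ S, c i * l.foldr pd (f i) x := by
  induction l with
  | nil => rfl
  | cons j l ih =>
    simp only [List.foldr_cons, ih]
    exact pd_sum_mul S c j fun i => contDiff_foldr_pd l (hf i)

theorem contDiff_pd_left {n : ℕ} (j : Fin n) {σ : (Fin n → ℝ) → (Fin n → ℝ) → ℂ}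
    (hσ : ContDiff ℝ (⊤ : ℕ∞) fun q : (Fin n → ℝ) × (Fin n → ℝ) => σ q.1 q.2) :
    ContDiff ℝ (⊤ : ℕ∞) fun q : (Fin n → ℝ) × (Fin n → ℝ) => pd j (fun x => σ x q.2) q.1 := by
  have h : (fun q : (Fin n → ℝ) × (Fin n → ℝ) => pd j (fun x => σ x q.2) q.1) =
      fun q => fderiv ℝ (fun q : (Fin n → ℝ) × (Fin n → ℝ) => σ q.1 q.2) q
        (Pi.single j 1, 0) := by
    funext q
    have h1 : HasFDerivAt (fun x : Fin n → ℝ => (x, q.2))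
        (ContinuousLinearMap.inl ℝ (Fin n → ℝ) (Fin n → ℝ)) q.1 :=
      hasFDerivAt_prodMk_left q.1 q.2
    have h2 := ((hσ.differentiable (by simp)).differentiableAt (x := q)).hasFDerivAt
    have h3 : HasFDerivAt (fun x => σ x q.2) _ q.1 :=
      HasFDerivAt.comp (g := fun q : (Fin n → ℝ) × (Fin n → ℝ) => σ q.1 q.2) q.1 h2 h1
    simp [pd, h3.fderiv]
  rw [h]
  exact (hσ.fderiv_right (m := ((⊤ : ℕ∞) : WithTop ℕ∞)) (by simp)).clm_apply contDiff_const

theorem contDiff_foldr_pd_left {n : ℕ} (l : List (Fin n)) {σ : (Fin n → ℝ) → (Fin n → ℝ) → ℂ}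
    (hσ : ContDiff ℝ (⊤ : ℕ∞) fun q : (Fin n → ℝ) × (Fin n → ℝ) => σ q.1 q.2) :
    ContDiff ℝ (⊤ : ℕ∞)
      fun q : (Fin n → ℝ) × (Fin n → ℝ) => l.foldr pd (fun x => σ x q.2) q.1 := by
  induction l with
  | nil => exact hσ
  | cons j l ih => exact contDiff_pd_left j (σ := fun x ξ => l.foldr pd (fun x' => σ x' ξ) x) ih

theorem hasDerivAt_comp_line {n : ℕ} {f : (Fin n → ℝ) → ℂ} (hf : ContDiff ℝ (⊤ : ℕ∞) f)
    (x v : Fin n → ℝ) (t : ℝ) :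
    HasDerivAt (fun t : ℝ => f (x + t • v)) (∑ i, (v i : ℂ) * pd i f (x + t • v)) t := by
  have h1 : HasDerivAt (fun t : ℝ => x + t • v) v t := by
    simpa using ((hasDerivAt_id t).smul_const v).const_add x
  have h2 := ((hf.differentiable (by simp)).differentiableAt (x := x + t • v)).hasFDerivAt
  refine (h2.comp_hasDerivAt t h1).congr_deriv ?_
  have hv : v = ∑ i, v i • (Pi.single i 1 : Fin n → ℝ) := by
    ext k
    simp [Finset.sum_apply, Pi.single_apply]
  have h3 : fderiv ℝ f (x + t • v) v = fderiv ℝ f (x + t • v) (∑ i, v i • Pi.single i 1) :=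
    congrArg _ hv
  rw [h3]
  simp [pd, map_sum]

theorem iteratedDeriv_comp_line_single {n : ℕ} (j : Fin n) (a : ℕ) {f : (Fin n → ℝ) → ℂ}
    (hf : ContDiff ℝ (⊤ : ℕ∞) f) (x : Fin n → ℝ) :
    iteratedDeriv a (fun t : ℝ => f (x + t • Pi.single j 1)) =
      fun t => (pd j)^[a] f (x + t • Pi.single j 1) := by
  induction a generalizing f with
  | zero => rfl
  | succ a ih =>
    rw [iteratedDeriv_succ', Function.iterate_succ_apply, ← ih (contDiff_pd j hf)]
    congr 1
    funext t
    rw [(hasDerivAt_comp_line hf x _ t).deriv]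
    rw [Finset.sum_eq_single j (fun i _ hi => by simp [hi]) (by simp)]
    simp

/-! ### The fundamental domain -/

theorem measurableSet_cube (n : ℕ) : MeasurableSet (cube n) :=
  MeasurableSet.univ_pi fun _ => measurableSet_Ico

theorem μT_eq_pi (n : ℕ) :
    μT n = Measure.pi fun _ : Fin n => (volume : Measure ℝ).restrict (Set.Ico 0 1) := by
  rw [μT, cube, volume_pi, Measure.restrict_pi_pi]

instance isProbabilityMeasure_μT (n : ℕ) : IsProbabilityMeasure (μT n) := by
  have : IsProbabilityMeasure ((volume : Measure ℝ).restrict (Set.Ico 0 1)) := ⟨by simp⟩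
  rw [μT_eq_pi]
  infer_instance

theorem lintegral_cube_contract_le {n : ℕ} {h : (Fin n → ℝ) → ℝ≥0∞} (hh : Measurable h)
    {x : Fin n → ℝ} (hx : x ∈ cube n) {r : ℝ} (hr0 : 0 < r) (hr1 : r ≤ 1) :
    ∫⁻ y, h (x + r • (y - x)) ∂(μT n) ≤ ENNReal.ofReal ((r ^ n)⁻¹) * ∫⁻ y, h y ∂(μT n) := by
  set H := (cube n).indicator h with hH
  have hHm : Measurable H := hh.indicator (measurableSet_cube n)
  have hconv : Convex ℝ (cube n) := convex_pi fun _ _ => convex_Ico 0 1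
  calc ∫⁻ y, h (x + r • (y - x)) ∂(μT n)
      = ∫⁻ y in cube n, H (x + r • (y - x)) := by
        refine setLIntegral_congr_fun (measurableSet_cube n) fun y hy => ?_
        have : x + r • (y - x) ∈ cube n := hconv.add_smul_sub_mem hx hy ⟨hr0.le, hr1⟩
        simp [hH, this]
    _ ≤ ∫⁻ y, H (x + r • (y - x)) := setLIntegral_le_lintegral _ _
    _ = ∫⁻ y, (fun z => H (z + (x - r • x))) (r • y) := by
        refine lintegral_congr fun y => ?_
        congr 1
        simp only [smul_sub]
        abel
    _ = ∫⁻ z, H (z + (x - r • x)) ∂(Measure.map (r • ·) volume) := by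
        rw [lintegral_map (f := fun z => H (z + (x - r • x))) (by fun_prop)
          (measurable_const_smul r)]
    _ = ENNReal.ofReal ((r ^ n)⁻¹) * ∫⁻ z, H z := by
        rw [Measure.map_addHaar_smul _ hr0.ne', lintegral_smul_measure,
          lintegral_add_right_eq_self H]
        simp [abs_of_pos hr0]
    _ = _ := by rw [hH, lintegral_indicator (measurableSet_cube n), μT]

/-! ### A Sobolev inequality on the cube -/

/-- The `j`-th derivative of `t ↦ u (x + t • v)`. -/
def lineDeriv' {n : ℕ} (u : (Fin n → ℝ) → ℂ) (x v : Fin n → ℝ) (j : ℕ) (t : ℝ) : ℂ :=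
  ∑ s : Fin j → Fin n, (∏ i, (v (s i) : ℂ)) * (List.ofFn s).foldr pd u (x + t • v)

theorem hasDerivAt_lineDeriv' {n : ℕ} {u : (Fin n → ℝ) → ℂ} (hu : ContDiff ℝ (⊤ : ℕ∞) u)
    (x v : Fin n → ℝ) (j : ℕ) (t : ℝ) :
    HasDerivAt (lineDeriv' u x v j) (lineDeriv' u x v (j + 1) t) t := by
  have h : HasDerivAt (lineDeriv' u x v j)
      (∑ s : Fin j → Fin n, (∏ i, (v (s i) : ℂ)) *
        ∑ i, (v i : ℂ) * pd i ((List.ofFn s).foldr pd u) (x + t • v)) t :=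
    HasDerivAt.fun_sum fun s _ =>
      (hasDerivAt_comp_line (contDiff_foldr_pd _ hu) x v t).const_mul _
  convert h using 1
  rw [lineDeriv', ← (Fin.consEquiv fun _ => Fin n).sum_comp, Fintype.sum_prod_type,
    Finset.sum_comm]
  refine Finset.sum_congr rfl fun s _ => ?_
  rw [Finset.mul_sum]
  refine Finset.sum_congr rfl fun i _ => ?_
  simp [Fin.consEquiv, Fin.prod_univ_succ, List.ofFn_succ]
  ring

theorem enorm_lineDeriv'_le {n : ℕ} (u : (Fin n → ℝ) → ℂ) (x : Fin n → ℝ) {v : Fin n → ℝ}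
    (hv : ∀ i, |v i| ≤ 1) (j : ℕ) (t : ℝ) :
    ‖lineDeriv' u x v j t‖ₑ ≤
      ∑ s : Fin j → Fin n, ‖(List.ofFn s).foldr pd u (x + t • v)‖ₑ := by
  refine (enorm_sum_le _ _).trans (Finset.sum_le_sum fun s _ => ?_)
  rw [enorm_mul]
  refine mul_le_of_le_one_left' ?_
  rw [← ofReal_norm, norm_prod]
  refine ENNReal.ofReal_le_one.2 (Finset.prod_le_one (fun _ _ => norm_nonneg _) fun i _ => ?_)
  simpa using hv (s i)

theorem enorm_le_taylor {G : ℕ → ℝ → ℂ} (hG : ∀ j t, HasDerivAt (G j) (G (j + 1) t) t) (k : ℕ) :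
    ‖G 0 0‖ₑ ≤ ∑ j ∈ Finset.range (k + 1), ‖G j 1‖ₑ +
      ∫⁻ r in Set.Ioc (0 : ℝ) 1, ENNReal.ofReal (r ^ k) * ‖G (k + 1) r‖ₑ := by
  set h : ℕ → ℝ → ℂ := fun k r =>
    ∑ j ∈ Finset.range (k + 1), (((-r) ^ j / (j.factorial : ℝ) : ℝ) : ℂ) * G j r with hh
  have hder : ∀ k r, HasDerivAt (h k)
      ((((-r) ^ k / (k.factorial : ℝ) : ℝ) : ℂ) * G (k + 1) r) r := by
    intro k r
    induction k with
    | zero => simpa [hh] using hG 0 r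
    | succ k ih =>
      have h1 : HasDerivAt (fun r : ℝ => (-r) ^ (k + 1) / ((k + 1).factorial : ℝ))
          (-((-r) ^ k / (k.factorial : ℝ))) r := by
        have := (((hasDerivAt_id r).neg.pow (k + 1)).div_const ((k + 1).factorial : ℝ))
        refine this.congr_deriv ?_
        simp only [Nat.factorial_succ, Nat.cast_mul]
        have h2 : ((k + 1 : ℕ) : ℝ) ≠ 0 := by positivity
        have h3 : (k.factorial : ℝ) ≠ 0 := by positivity
        simp
        field_simp
      have h2 := ih.add (h1.ofReal_comp.mul (hG (k + 1) r))
      have h3 : h (k + 1) = fun r => h k r +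
          (((-r) ^ (k + 1) / ((k + 1).factorial : ℝ) : ℝ) : ℂ) * G (k + 1) r := by
        funext r
        simp only [hh]
        rw [Finset.sum_range_succ]
      rw [h3]
      refine h2.congr_deriv ?_
      push_cast
      ring
  have hcont : ∀ j, Continuous (G j) := fun j =>
    continuous_iff_continuousAt.2 fun t => (hG j t).continuousAt
  have h_int : ∫ r in (0 : ℝ)..1, (((-r) ^ k / (k.factorial : ℝ) : ℝ) : ℂ) * G (k + 1) r =
      h k 1 - h k 0 := by
    refine intervalIntegral.integral_eq_sub_of_hasDerivAt (fun r _ => hder k r) ?_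
    refine Continuous.intervalIntegrable ?_ _ _
    have := hcont (k + 1)
    fun_prop
  have h0 : h k 0 = G 0 0 := by
    simp only [hh]
    rw [Finset.sum_eq_single 0]
    · simp
    · intro j _ hj
      simp [hj]
    · simp
  have hc : ∀ (r : ℝ) (j : ℕ), 0 ≤ r →
      ‖(((-r) ^ j / (j.factorial : ℝ) : ℝ) : ℂ)‖ₑ ≤ ENNReal.ofReal (r ^ j) := by
    intro r j hr
    rw [← ofReal_norm]
    refine ENNReal.ofReal_le_ofReal ?_
    rw [Complex.norm_real, norm_div, norm_pow, norm_neg, Real.norm_of_nonneg hr]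
    refine div_le_self (by positivity) ?_
    simpa using Nat.one_le_iff_ne_zero.2 j.factorial_ne_zero
  have hsplit : G 0 0 = h k 1 -
      ∫ r in (0 : ℝ)..1, (((-r) ^ k / (k.factorial : ℝ) : ℝ) : ℂ) * G (k + 1) r := by
    rw [h_int, h0]
    ring
  rw [hsplit]
  refine enorm_sub_le.trans (add_le_add ?_ ?_)
  · refine (enorm_sum_le _ _).trans (Finset.sum_le_sum fun j _ => ?_)
    rw [enorm_mul]
    refine mul_le_of_le_one_left' ((hc 1 j zero_le_one).trans ?_)
    simp
  · rw [intervalIntegral.integral_of_le zero_le_one]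
    refine (enorm_integral_le_lintegral_enorm _).trans
      (setLIntegral_mono' measurableSet_Ioc fun r hr => ?_)
    rw [enorm_mul]
    gcongr
    exact hc r k hr.1.le

theorem enorm_le_sum_eLpNorm_of_contDiff {n : ℕ} {p : ℝ} (hp : 1 ≤ p) {k : ℕ}
    (hk : (n : ℝ) / p < k + 1) :
    ∃ A : ℝ≥0∞, A ≠ ⊤ ∧ ∀ u : (Fin n → ℝ) → ℂ, ContDiff ℝ (⊤ : ℕ∞) u → ∀ x ∈ cube n,
      ‖u x‖ₑ ≤ A * ∑ j ∈ Finset.range (k + 2), ∑ s : Fin j → Fin n,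
        eLpNorm ((List.ofFn s).foldr pd u) (ENNReal.ofReal p) (μT n) := by
  have hp0 : 0 < p := by linarith
  have hP1 : 1 ≤ ENNReal.ofReal p := by simpa using hp
  have hP0 : ENNReal.ofReal p ≠ 0 := by simpa using hp0
  set I : ℝ≥0∞ := ∫⁻ r in Set.Ioc (0 : ℝ) 1, ENNReal.ofReal (r ^ ((k : ℝ) - n / p)) with hI
  have hItop : I ≠ ⊤ := by
    have h1 : IntegrableOn (fun r : ℝ => r ^ ((k : ℝ) - n / p)) (Set.Ioc 0 1) := by
      have := (intervalIntegral.intervalIntegrable_rpow' (a := 0) (b := 1)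
        (r := (k : ℝ) - n / p) (by linarith))
      rwa [intervalIntegrable_iff_integrableOn_Ioc_of_le zero_le_one] at this
    exact h1.lintegral_lt_top.ne
  refine ⟨1 + I, by simp [hItop], fun u hu x hx => ?_⟩
  have hcd : ∀ l : List (Fin n), Continuous (l.foldr pd u) := fun l =>
    (contDiff_foldr_pd l hu).continuous
  set N : (j : ℕ) → (Fin j → Fin n) → ℝ≥0∞ := fun j s =>
    eLpNorm ((List.ofFn s).foldr pd u) (ENNReal.ofReal p) (μT n) with hN
  have hone : ∀ g : (Fin n → ℝ) → ℂ, Continuous g →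
      ∫⁻ y, ‖g y‖ₑ ∂(μT n) ≤ eLpNorm g (ENNReal.ofReal p) (μT n) := by
    intro g hg
    rw [← eLpNorm_one_eq_lintegral_enorm]
    exact eLpNorm_le_eLpNorm_of_exponent_le hP1 hg.aestronglyMeasurable
  have hcontr : ∀ g : (Fin n → ℝ) → ℂ, Continuous g → ∀ r ∈ Set.Ioc (0 : ℝ) 1,
      ∫⁻ y, ‖g (x + r • (y - x))‖ₑ ∂(μT n) ≤
        ENNReal.ofReal (r ^ (-(n / p))) * eLpNorm g (ENNReal.ofReal p) (μT n) := by
    intro g hg r hr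
    refine (hone (fun y => g (x + r • (y - x))) (by fun_prop)).trans ?_
    rw [eLpNorm_eq_lintegral_rpow_enorm_toReal hP0 (by simp),
      eLpNorm_eq_lintegral_rpow_enorm_toReal hP0 (by simp), ENNReal.toReal_ofReal hp0.le]
    have hmeas : Measurable fun y => ‖g y‖ₑ ^ p := by
      have := hg.measurable
      fun_prop
    have h2 := lintegral_cube_contract_le hmeas hx hr.1 hr.2
    have h3 : ENNReal.ofReal ((r ^ n)⁻¹) ^ (1 / p) = ENNReal.ofReal (r ^ (-(n / p))) := by
      rw [ENNReal.ofReal_rpow_of_pos (by have := hr.1; positivity), ← Real.rpow_natCast,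
        ← Real.rpow_neg hr.1.le, ← Real.rpow_mul hr.1.le]
      congr 2
      ring
    calc _ ≤ (ENNReal.ofReal ((r ^ n)⁻¹) * ∫⁻ y, ‖g y‖ₑ ^ p ∂(μT n)) ^ (1 / p) := by
          gcongr
      _ = _ := by rw [ENNReal.mul_rpow_of_nonneg _ _ (by positivity), h3]
  have hpt : ∀ y ∈ cube n, ‖u x‖ₑ ≤
      ∑ j ∈ Finset.range (k + 1), ∑ s : Fin j → Fin n, ‖(List.ofFn s).foldr pd u y‖ₑ +
      ∫⁻ r in Set.Ioc (0 : ℝ) 1, ENNReal.ofReal (r ^ k) *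
        ∑ s : Fin (k + 1) → Fin n, ‖(List.ofFn s).foldr pd u (x + r • (y - x))‖ₑ := by
    intro y hy
    have hv : ∀ i, |(y - x) i| ≤ 1 := by
      intro i
      have h1 := hx i trivial
      have h2 := hy i trivial
      simp only [Set.mem_Ico] at h1 h2
      rw [Pi.sub_apply, abs_le]
      constructor <;> linarith [h1.1, h1.2, h2.1, h2.2]
    have h := enorm_le_taylor (hasDerivAt_lineDeriv' hu x (y - x)) k
    have h0 : lineDeriv' u x (y - x) 0 0 = u x := by simp [lineDeriv']
    rw [h0] at h
    refine h.trans (add_le_add (Finset.sum_le_sum fun j _ => ?_) ?_)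
    · simpa using enorm_lineDeriv'_le u x hv j 1
    · refine lintegral_mono fun r => ?_
      gcongr
      exact enorm_lineDeriv'_le u x hv (k + 1) r
  calc ‖u x‖ₑ = ∫⁻ _, ‖u x‖ₑ ∂(μT n) := by simp
    _ ≤ ∫⁻ y, (∑ j ∈ Finset.range (k + 1), ∑ s : Fin j → Fin n,
          ‖(List.ofFn s).foldr pd u y‖ₑ +
        ∫⁻ r in Set.Ioc (0 : ℝ) 1, ENNReal.ofReal (r ^ k) *
          ∑ s : Fin (k + 1) → Fin n, ‖(List.ofFn s).foldr pd u (x + r • (y - x))‖ₑ) ∂(μT n) :=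
        setLIntegral_mono' (measurableSet_cube n) hpt
    _ = ∑ j ∈ Finset.range (k + 1), ∑ s : Fin j → Fin n,
          ∫⁻ y, ‖(List.ofFn s).foldr pd u y‖ₑ ∂(μT n) +
        ∫⁻ r in Set.Ioc (0 : ℝ) 1, ENNReal.ofReal (r ^ k) *
          ∑ s : Fin (k + 1) → Fin n,
            ∫⁻ y, ‖(List.ofFn s).foldr pd u (x + r • (y - x))‖ₑ ∂(μT n) := by
        have hm : ∀ l : List (Fin n), Measurable fun y => ‖l.foldr pd u y‖ₑ := fun l =>
          (hcd l).measurable.enorm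
        have hj : ∀ l : List (Fin n), Measurable
            fun q : (Fin n → ℝ) × ℝ => ‖l.foldr pd u (x + q.2 • (q.1 - x))‖ₑ := fun l =>
          (hm l).comp (g := fun y => ‖l.foldr pd u y‖ₑ) (by fun_prop)
        have hr : ∀ (r : ℝ) (l : List (Fin n)), Measurable
            fun y => ‖l.foldr pd u (x + r • (y - x))‖ₑ := fun r l =>
          (hm l).comp (g := fun y => ‖l.foldr pd u y‖ₑ) (by fun_prop)
        rw [lintegral_add_left (by fun_prop)]
        congr 1
        · rw [lintegral_finsetSum _ (by fun_prop)]
          refine Finset.sum_congr rfl fun j _ => ?_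
          rw [lintegral_finsetSum _ (by fun_prop)]
        · rw [lintegral_lintegral_swap]
          · refine lintegral_congr fun r => ?_
            rw [lintegral_const_mul _ (Finset.measurable_fun_sum _ fun s _ => hr r _),
              lintegral_finsetSum _ fun s _ => hr r _]
          · refine Measurable.aemeasurable ?_
            exact Measurable.mul (by fun_prop) (Finset.measurable_fun_sum _ fun s _ => hj _)
    _ ≤ ∑ j ∈ Finset.range (k + 1), ∑ s : Fin j → Fin n, N j s +
        ∫⁻ r in Set.Ioc (0 : ℝ) 1, ENNReal.ofReal (r ^ ((k : ℝ) - n / p)) *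
          ∑ s : Fin (k + 1) → Fin n, N (k + 1) s := by
        refine add_le_add (Finset.sum_le_sum fun j _ => Finset.sum_le_sum fun s _ =>
          hone _ (hcd _)) (setLIntegral_mono' measurableSet_Ioc fun r hr => ?_)
        have h1 : ENNReal.ofReal (r ^ ((k : ℝ) - n / p)) =
            ENNReal.ofReal (r ^ k) * ENNReal.ofReal (r ^ (-(n / p))) := by
          rw [← ENNReal.ofReal_mul (pow_nonneg hr.1.le k), ← Real.rpow_natCast,
            ← Real.rpow_add hr.1, sub_eq_add_neg]
        rw [h1, mul_assoc]
        gcongr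
        rw [Finset.mul_sum]
        exact Finset.sum_le_sum fun s _ => hcontr _ (hcd _) r hr
    _ = ∑ j ∈ Finset.range (k + 1), ∑ s : Fin j → Fin n, N j s +
        I * ∑ s : Fin (k + 1) → Fin n, N (k + 1) s := by
        rw [lintegral_mul_const _ (by fun_prop)]
    _ ≤ (1 + I) * ∑ j ∈ Finset.range (k + 2), ∑ s : Fin j → Fin n, N j s := by
        rw [Finset.sum_range_succ _ (k + 1), mul_add]
        exact add_le_add (le_mul_of_one_le_left' (by simp)) (mul_le_mul_left (by simp) _)

/-! ### Trigonometric polynomials on the torus -/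

theorem Continuous.integrable_μT {n : ℕ} {E : Type*} [NormedAddCommGroup E]
    {f : (Fin n → ℝ) → E} (hf : Continuous f) : Integrable f (μT n) := by
  have hc : IsCompact (Set.univ.pi fun _ : Fin n => Set.Icc (0 : ℝ) 1) :=
    isCompact_univ_pi fun _ => isCompact_Icc
  exact (hf.continuousOn.integrableOn_compact hc).mono_set
    (Set.pi_mono fun _ _ => Set.Ico_subset_Icc_self)

theorem eChar_eq_prod {n : ℕ} (x : Fin n → ℝ) (ξ : Fin n → ℤ) :
    eChar x ξ = ∏ j, Complex.exp (2 * (π : ℂ) * Complex.I * (ξ j : ℂ) * (x j : ℂ)) := by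
  rw [eChar, ← Complex.exp_sum, Finset.mul_sum]
  congr 1
  exact Finset.sum_congr rfl fun j _ => by ring

theorem eChar_eq_exp_mul_I {n : ℕ} (x : Fin n → ℝ) (ξ : Fin n → ℤ) :
    eChar x ξ = Complex.exp ((2 * π * ∑ j, x j * ξ j : ℝ) * Complex.I) := by
  rw [eChar]
  congr 1
  push_cast
  ring

theorem eChar_add {n : ℕ} (x : Fin n → ℝ) (ξ η : Fin n → ℤ) :
    eChar x (ξ + η) = eChar x ξ * eChar x η := by
  simp only [eChar, ← Complex.exp_add, ← mul_add, ← Finset.sum_add_distrib]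
  simp [mul_add]

theorem eChar_add_left {n : ℕ} (x y : Fin n → ℝ) (ξ : Fin n → ℤ) :
    eChar (x + y) ξ = eChar x ξ * eChar y ξ := by
  simp only [eChar, ← Complex.exp_add, ← mul_add, ← Finset.sum_add_distrib]
  simp [add_mul]

theorem eChar_neg_left {n : ℕ} (x : Fin n → ℝ) (ξ : Fin n → ℤ) :
    eChar (-x) ξ = Complex.exp (-(2 * (π : ℂ) * Complex.I) * ∑ j, (x j : ℂ) * (ξ j : ℂ)) := by
  rw [eChar]
  congr 1
  simp

theorem conj_eChar {n : ℕ} (x : Fin n → ℝ) (ξ : Fin n → ℤ) :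
    (starRingEnd ℂ) (eChar x ξ) = eChar x (-ξ) := by
  rw [eChar_eq_exp_mul_I, eChar_eq_exp_mul_I, ← Complex.exp_conj, map_mul, Complex.conj_I,
    Complex.conj_ofReal]
  congr 1
  push_cast
  simp

@[fun_prop]
theorem continuous_eChar {n : ℕ} (ξ : Fin n → ℤ) : Continuous fun x : Fin n → ℝ => eChar x ξ := by
  unfold eChar
  fun_prop

theorem eChar_intCast {n : ℕ} (v ξ : Fin n → ℤ) : eChar (fun j => (v j : ℝ)) ξ = 1 := by
  rw [eChar, Complex.exp_eq_one_iff]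
  refine ⟨∑ j, v j * ξ j, ?_⟩
  push_cast
  ring

theorem integral_eChar {n : ℕ} (ξ : Fin n → ℤ) :
    ∫ x, eChar x ξ ∂(μT n) = if ξ = 0 then 1 else 0 := by
  simp only [eChar_eq_prod]
  rw [μT_eq_pi, integral_fintype_prod_eq_prod
    (f := fun (j : Fin n) (t : ℝ) => Complex.exp (2 * (π : ℂ) * Complex.I * (ξ j : ℂ) * (t : ℂ)))]
  have h1 : ∀ m : ℤ, ∫ t in Set.Ico (0 : ℝ) 1,
      Complex.exp (2 * (π : ℂ) * Complex.I * (m : ℂ) * (t : ℂ)) = if m = 0 then 1 else 0 := by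
    intro m
    rw [integral_Ico_eq_integral_Ioo, ← integral_Ioc_eq_integral_Ioo,
      ← intervalIntegral.integral_of_le zero_le_one]
    split_ifs with hm
    · simp [hm]
    · rw [integral_exp_mul_complex (by simp [hm, Real.pi_ne_zero])]
      have : Complex.exp (2 * (π : ℂ) * Complex.I * (m : ℂ) * ((1 : ℝ) : ℂ)) = 1 :=
        Complex.exp_eq_one_iff.2 ⟨m, by push_cast; ring⟩
      rw [this]
      simp
  simp only [h1]
  split_ifs with h
  · simp [h]
  · obtain ⟨j, hj⟩ := Function.ne_iff.1 h
    exact Finset.prod_eq_zero (Finset.mem_univ j) (by simpa using hj)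

theorem integral_norm_sq_sum_eChar {n : ℕ} (S : Finset (Fin n → ℤ)) (c : (Fin n → ℤ) → ℂ) :
    ∫ x, ‖∑ ξ ∈ S, c ξ * eChar x ξ‖ ^ 2 ∂(μT n) = ∑ ξ ∈ S, ‖c ξ‖ ^ 2 := by
  have h : ∀ x : Fin n → ℝ, ((‖∑ ξ ∈ S, c ξ * eChar x ξ‖ ^ 2 : ℝ) : ℂ) =
      ∑ ξ ∈ S, ∑ η ∈ S, c ξ * (starRingEnd ℂ) (c η) * eChar x (ξ - η) := by
    intro x
    push_cast
    rw [← Complex.mul_conj', map_sum, Finset.sum_mul_sum]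
    refine Finset.sum_congr rfl fun ξ _ => Finset.sum_congr rfl fun η _ => ?_
    rw [map_mul, conj_eChar, sub_eq_add_neg, eChar_add]
    ring
  have h2 : ((∫ x, ‖∑ ξ ∈ S, c ξ * eChar x ξ‖ ^ 2 ∂(μT n) : ℝ) : ℂ) =
      ((∑ ξ ∈ S, ‖c ξ‖ ^ 2 : ℝ) : ℂ) := by
    rw [← integral_complex_ofReal]
    simp only [h]
    rw [integral_finsetSum _ fun ξ _ => Continuous.integrable_μT (by fun_prop)]
    push_cast
    refine Finset.sum_congr rfl fun ξ hξ => ?_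
    rw [integral_finsetSum _ fun η _ => Continuous.integrable_μT (by fun_prop)]
    simp only [integral_const_mul, integral_eChar, sub_eq_zero]
    rw [← Complex.mul_conj']
    simp [hξ]
  exact_mod_cast h2

/-- The lattice points of sup-norm at most `M`. -/
def latticeBox (n M : ℕ) : Finset (Fin n → ℤ) :=
  Finset.Icc (fun _ => -(M : ℤ)) (fun _ => (M : ℤ))

theorem mem_latticeBox {n M : ℕ} {ξ : Fin n → ℤ} : ξ ∈ latticeBox n M ↔ ∀ j, |ξ j| ≤ M := by
  simp only [latticeBox, Finset.mem_Icc, Pi.le_def, abs_le, forall_and]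

theorem card_latticeBox (n M : ℕ) : (latticeBox n M).card = (2 * M + 1) ^ n := by
  rw [latticeBox, Pi.card_Icc]
  simp only [Int.card_Icc, Finset.prod_const, Finset.card_univ, Fintype.card_fin]
  congr 1
  omega

theorem latticeBox_mono {n M M' : ℕ} (h : M ≤ M') : latticeBox n M ⊆ latticeBox n M' := by
  intro ξ hξ
  rw [mem_latticeBox] at hξ ⊢
  exact fun j => (hξ j).trans (by exact_mod_cast h)

theorem dd_eq_zero_of_notMem_latticeBox {n M : ℕ} {c : (Fin n → ℤ) → ℂ}
    (hc : ∀ ξ, ξ ∉ latticeBox n M → c ξ = 0) (j : Fin n) {ξ : Fin n → ℤ}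
    (hξ : ξ ∉ latticeBox n (M + 1)) : dd j c ξ = 0 := by
  rw [dd, hc ξ (fun h => hξ (latticeBox_mono (Nat.le_succ M) h)), hc, sub_zero]
  intro h
  refine hξ ?_
  rw [mem_latticeBox] at h ⊢
  intro i
  have hi := h i
  by_cases hij : i = j
  · subst hij
    simp only [Pi.add_apply, Pi.single_eq_same, abs_le] at hi
    rw [abs_le]
    push_cast
    constructor <;> linarith [hi.1, hi.2]
  · simp only [Pi.add_apply, Pi.single_eq_of_ne hij, add_zero] at hi
    push_cast
    linarith

theorem iterate_dd_eq_zero_of_notMem_latticeBox {n M : ℕ} {c : (Fin n → ℤ) → ℂ}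
    (hc : ∀ ξ, ξ ∉ latticeBox n M → c ξ = 0) (j : Fin n) (N : ℕ) :
    ∀ ξ, ξ ∉ latticeBox n (M + N) → (dd j)^[N] c ξ = 0 := by
  induction N with
  | zero => exact hc
  | succ N ih =>
    intro ξ hξ
    rw [Function.iterate_succ_apply']
    exact dd_eq_zero_of_notMem_latticeBox ih j hξ

theorem summable_mul_eChar {n M : ℕ} {c : (Fin n → ℤ) → ℂ}
    (hc : ∀ ξ, ξ ∉ latticeBox n M → c ξ = 0) (x : Fin n → ℝ) :
    Summable fun ξ => c ξ * eChar x ξ :=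
  summable_of_ne_finset_zero (s := latticeBox n M) fun ξ hξ => by rw [hc ξ hξ, zero_mul]

theorem tsum_mul_eChar_eq_sum {n M : ℕ} {c : (Fin n → ℤ) → ℂ}
    (hc : ∀ ξ, ξ ∉ latticeBox n M → c ξ = 0) (x : Fin n → ℝ) :
    ∑' ξ, c ξ * eChar x ξ = ∑ ξ ∈ latticeBox n M, c ξ * eChar x ξ :=
  tsum_eq_sum fun ξ hξ => by rw [hc ξ hξ, zero_mul]

theorem sub_one_mul_tsum_eChar {n M : ℕ} {c : (Fin n → ℤ) → ℂ}
    (hc : ∀ ξ, ξ ∉ latticeBox n M → c ξ = 0) (j : Fin n) (x : Fin n → ℝ) :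
    (eChar x (-Pi.single j 1) - 1) * ∑' ξ, c ξ * eChar x ξ = ∑' ξ, dd j c ξ * eChar x ξ := by
  have hs := summable_mul_eChar hc x
  have h1 : (fun ξ => c (ξ + Pi.single j 1) * eChar x ξ) =
      (fun ξ => eChar x (-Pi.single j 1) * (c ξ * eChar x ξ)) ∘
        (Equiv.addRight (Pi.single j 1 : Fin n → ℤ)) := by
    funext ξ
    have : eChar x ξ = eChar x (-Pi.single j 1) * eChar x (ξ + Pi.single j 1) := by
      rw [← eChar_add]
      congr 1
      abel
    simp only [Function.comp_apply, Equiv.coe_addRight]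
    rw [this]
    ring
  have hs' : Summable fun ξ => c (ξ + Pi.single j 1) * eChar x ξ := by
    rw [h1]
    exact (Equiv.summable_iff _).2 (hs.mul_left _)
  have h2 : ∑' ξ, c (ξ + Pi.single j 1) * eChar x ξ =
      eChar x (-Pi.single j 1) * ∑' ξ, c ξ * eChar x ξ := by
    rw [h1, ← tsum_mul_left]
    exact Equiv.tsum_eq (Equiv.addRight (Pi.single j 1 : Fin n → ℤ))
      (fun ξ => eChar x (-Pi.single j 1) * (c ξ * eChar x ξ))
  rw [sub_mul, one_mul, ← h2, ← hs'.tsum_sub hs]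
  simp only [dd, sub_mul]

theorem sub_one_pow_mul_tsum_eChar {n M : ℕ} {c : (Fin n → ℤ) → ℂ}
    (hc : ∀ ξ, ξ ∉ latticeBox n M → c ξ = 0) (j : Fin n) (N : ℕ) (x : Fin n → ℝ) :
    (eChar x (-Pi.single j 1) - 1) ^ N * ∑' ξ, c ξ * eChar x ξ =
      ∑' ξ, (dd j)^[N] c ξ * eChar x ξ := by
  induction N with
  | zero => simp
  | succ N ih =>
    rw [pow_succ', mul_assoc, ih,
      sub_one_mul_tsum_eChar (iterate_dd_eq_zero_of_notMem_latticeBox hc j N),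
      ← Function.iterate_succ_apply' (dd j)]

theorem integral_norm_sq_tsum_eChar_le {n M : ℕ} {c : (Fin n → ℤ) → ℂ}
    (hc : ∀ ξ, ξ ∉ latticeBox n M → c ξ = 0) {B : ℝ} (hB : ∀ ξ, ‖c ξ‖ ≤ B) :
    ∫ x, ‖∑' ξ, c ξ * eChar x ξ‖ ^ 2 ∂(μT n) ≤ (2 * M + 1) ^ n * B ^ 2 := by
  simp only [tsum_mul_eChar_eq_sum hc]
  rw [integral_norm_sq_sum_eChar]
  refine (Finset.sum_le_card_nsmul _ _ (B ^ 2) fun ξ _ => ?_).trans ?_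
  · have := hB ξ
    gcongr
  · rw [card_latticeBox]
    simp

theorem continuous_tsum_eChar {n M : ℕ} {c : (Fin n → ℤ) → ℂ}
    (hc : ∀ ξ, ξ ∉ latticeBox n M → c ξ = 0) :
    Continuous fun x : Fin n → ℝ => ∑' ξ, c ξ * eChar x ξ := by
  simp only [tsum_mul_eChar_eq_sum hc]
  fun_prop

theorem sq_le_mul_of_forall_two_mul_le {I X Y : ℝ} (hI : 0 ≤ I) (hX : 0 ≤ X) (hY : 0 < Y)
    (h : ∀ t > 0, 2 * I ≤ t * X + t⁻¹ * Y) : I ^ 2 ≤ X * Y := by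
  rcases hI.eq_or_lt with rfl | hI
  · simpa using mul_nonneg hX hY.le
  · have h1 := h (Y / I) (by positivity)
    have h2 : (Y / I)⁻¹ * Y = I := by field_simp
    rw [h2] at h1
    have h3 : I ≤ Y / I * X := by linarith
    have h4 : I * I ≤ Y / I * X * I := by gcongr
    have h5 : Y / I * X * I = X * Y := by field_simp
    nlinarith

theorem integral_norm_tsum_eChar_sq_le {n M N : ℕ} {c : (Fin n → ℤ) → ℂ}
    (hc : ∀ ξ, ξ ∉ latticeBox n M → c ξ = 0) {B L Y : ℝ} (hL : 0 < L) (hY : 0 < Y)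
    (hB : ∀ ξ, ‖c ξ‖ ≤ B) (hBN : ∀ j ξ, L ^ N * ‖(dd j)^[N] c ξ‖ ≤ B)
    (hW : ∫ x, (1 + ∑ j : Fin n, (L * ‖eChar x (-Pi.single j 1) - 1‖) ^ (2 * N))⁻¹ ∂(μT n) ≤ Y) :
    (∫ x, ‖∑' ξ, c ξ * eChar x ξ‖ ∂(μT n)) ^ 2 ≤
      (n + 1) * (2 * (M + N) + 1) ^ n * B ^ 2 * Y := by
  set K : (Fin n → ℝ) → ℂ := fun x => ∑' ξ, c ξ * eChar x ξ with hK
  set D : (Fin n → ℝ) → ℝ := fun x =>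
    1 + ∑ j : Fin n, (L * ‖eChar x (-Pi.single j 1) - 1‖) ^ (2 * N) with hD
  have hKc : Continuous K := continuous_tsum_eChar hc
  have hDc : Continuous D := by fun_prop
  have hD1 : ∀ x, 1 ≤ D x := fun x =>
    le_add_of_nonneg_right (Finset.sum_nonneg fun j _ => by positivity)
  have hDi : Continuous fun x => (D x)⁻¹ :=
    hDc.inv₀ fun x => (zero_lt_one.trans_le (hD1 x)).ne'
  have hX : ∫ x, ‖K x‖ ^ 2 * D x ∂(μT n) ≤ (n + 1) * (2 * (M + N) + 1) ^ n * B ^ 2 := by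
    have h1 : ∀ x, ‖K x‖ ^ 2 * D x = ‖∑' ξ, c ξ * eChar x ξ‖ ^ 2 +
        ∑ j : Fin n, ‖∑' ξ, ((L : ℂ) ^ N * (dd j)^[N] c ξ) * eChar x ξ‖ ^ 2 := by
      intro x
      simp only [hD, hK, mul_add, mul_one, Finset.mul_sum, mul_assoc, tsum_mul_left]
      congr 1
      refine Finset.sum_congr rfl fun j _ => ?_
      rw [← sub_one_pow_mul_tsum_eChar hc j N x]
      simp only [norm_mul, norm_pow, Complex.norm_real, Real.norm_of_nonneg hL.le]
      ring
    have hc' : ∀ (j : Fin n) ξ, ξ ∉ latticeBox n (M + N) →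
        (L : ℂ) ^ N * (dd j)^[N] c ξ = 0 := fun j ξ hξ => by
      rw [iterate_dd_eq_zero_of_notMem_latticeBox hc j N ξ hξ, mul_zero]
    have hcc := continuous_tsum_eChar hc
    have hcc' := fun j => continuous_tsum_eChar (hc' j)
    simp only [h1]
    rw [integral_add (Continuous.integrable_μT (by fun_prop))
      (Continuous.integrable_μT (by fun_prop)),
      integral_finsetSum _ fun j _ => Continuous.integrable_μT (by fun_prop)]
    have e1 : ∫ x, ‖∑' ξ, c ξ * eChar x ξ‖ ^ 2 ∂(μT n) ≤ (2 * (M + N) + 1) ^ n * B ^ 2 := by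
      refine (integral_norm_sq_tsum_eChar_le hc hB).trans ?_
      gcongr
      simp
    have e2 : ∀ j, ∫ x, ‖∑' ξ, ((L : ℂ) ^ N * (dd j)^[N] c ξ) * eChar x ξ‖ ^ 2 ∂(μT n) ≤
        (2 * (M + N) + 1) ^ n * B ^ 2 := by
      intro j
      have := integral_norm_sq_tsum_eChar_le (hc' j) (B := B) fun ξ => by
        simpa [abs_of_pos hL] using hBN j ξ
      simpa using this
    refine (add_le_add e1 (Finset.sum_le_card_nsmul _ _ _ fun j _ => e2 j)).trans_eq ?_
    simp
    ring
  have hB0 : 0 ≤ B := (norm_nonneg _).trans (hB 0)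
  refine sq_le_mul_of_forall_two_mul_le (integral_nonneg fun x => norm_nonneg _)
    (by positivity) hY fun t ht => ?_
  calc 2 * ∫ x, ‖K x‖ ∂(μT n) = ∫ x, 2 * ‖K x‖ ∂(μT n) := by rw [integral_const_mul]
    _ ≤ ∫ x, (t * (‖K x‖ ^ 2 * D x) + t⁻¹ * (D x)⁻¹) ∂(μT n) := by
        refine integral_mono (Continuous.integrable_μT (by fun_prop))
          (Continuous.integrable_μT (by fun_prop)) fun x => ?_
        have hDx : 0 < D x := zero_lt_one.trans_le (hD1 x)
        have h2 : t * (‖K x‖ ^ 2 * D x) + t⁻¹ * (D x)⁻¹ - 2 * ‖K x‖ =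
            (t * D x)⁻¹ * (t * D x * ‖K x‖ - 1) ^ 2 := by
          field_simp
          ring
        have h3 : 0 ≤ (t * D x)⁻¹ * (t * D x * ‖K x‖ - 1) ^ 2 := by positivity
        simp only
        linarith
    _ = t * ∫ x, ‖K x‖ ^ 2 * D x ∂(μT n) + t⁻¹ * ∫ x, (D x)⁻¹ ∂(μT n) := by
        rw [integral_add (Continuous.integrable_μT (by fun_prop))
          (Continuous.integrable_μT (by fun_prop)), integral_const_mul, integral_const_mul]
    _ ≤ _ := by gcongr

/-! ### Integrals of inverse weights -/

theorem integrable_rpow_one_add_pow {n N : ℕ} (hn : 1 ≤ n) (hN : n < 2 * N) :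
    Integrable fun u : ℝ => (1 + |u| ^ (2 * N)) ^ (-(1 / (n : ℝ))) := by
  have hn' : (0 : ℝ) < n := by exact_mod_cast hn
  have hr : (1 : ℝ) < 2 * N / n := by
    rw [lt_div_iff₀ hn', one_mul]; exact_mod_cast hN
  have hi : Integrable fun u : ℝ => (1 + ‖u‖) ^ (-(2 * N / n : ℝ)) :=
    integrable_one_add_norm (by simpa using hr)
  refine (hi.const_mul ((2 : ℝ) ^ (2 * N / n : ℝ))).mono' ?_ (Filter.Eventually.of_forall ?_)
  · refine Continuous.aestronglyMeasurable ?_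
    refine Continuous.rpow_const (by fun_prop) fun u => Or.inl ?_
    positivity
  · intro u
    have h0 : (0 : ℝ) ≤ |u| := abs_nonneg u
    have h1 : ((1 + |u|) / 2) ^ (2 * N) ≤ 1 + |u| ^ (2 * N) := by
      rcases le_total |u| 1 with h | h
      · have : ((1 + |u|) / 2) ^ (2 * N) ≤ 1 := pow_le_one₀ (by positivity) (by linarith)
        linarith [pow_nonneg h0 (2 * N)]
      · have : ((1 + |u|) / 2) ^ (2 * N) ≤ |u| ^ (2 * N) :=
          pow_le_pow_left₀ (by positivity) (by linarith) _
        linarith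
    rw [Real.norm_of_nonneg (by positivity), Real.norm_eq_abs]
    calc (1 + |u| ^ (2 * N)) ^ (-(1 / (n : ℝ)))
        ≤ (((1 + |u|) / 2) ^ (2 * N)) ^ (-(1 / (n : ℝ))) :=
          Real.rpow_le_rpow_of_nonpos (by positivity) h1 (by simp)
      _ = ((1 + |u|) / 2) ^ (-(2 * N / n : ℝ)) := by
          rw [← Real.rpow_natCast, ← Real.rpow_mul (by positivity)]
          congr 1
          push_cast
          ring
      _ = 2 ^ (2 * N / n : ℝ) * (1 + |u|) ^ (-(2 * N / n : ℝ)) := by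
          rw [Real.div_rpow (by positivity) (by positivity), Real.rpow_neg zero_le_two,
            div_inv_eq_mul, mul_comm]

theorem four_mul_min_le_norm_exp_sub_one {z : ℝ} (h0 : 0 ≤ z) (h1 : z ≤ 1) :
    4 * min z (1 - z) ≤ ‖Complex.exp (2 * (π : ℂ) * Complex.I * (-z : ℂ)) - 1‖ := by
  have e : (2 * (π : ℂ) * Complex.I * (-z : ℂ)) = Complex.I * ((-(2 * π * z) : ℝ) : ℂ) := by
    push_cast; ring
  rw [e, Complex.norm_exp_I_mul_ofReal_sub_one, norm_mul, Real.norm_eq_abs, Real.norm_eq_abs,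
    abs_of_pos (two_pos : (0 : ℝ) < 2), neg_div, Real.sin_neg, abs_neg,
    show 2 * π * z / 2 = π * z by ring]
  have key : ∀ t : ℝ, 0 ≤ t → t ≤ 1 / 2 → 2 * t ≤ Real.sin (π * t) := by
    intro t ht ht'
    have := Real.mul_le_sin (x := π * t) (by positivity) (by nlinarith [Real.pi_pos])
    calc 2 * t = 2 / π * (π * t) := by field_simp
      _ ≤ _ := this
  rcases le_total z (1 / 2) with h | h
  · have := key z h0 h
    have h2 := min_le_left z (1 - z)
    linarith [le_abs_self (Real.sin (π * z))]
  · have := key (1 - z) (by linarith) (by linarith)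
    rw [show π * (1 - z) = π - π * z by ring, Real.sin_pi_sub] at this
    have h2 := min_le_right z (1 - z)
    linarith [le_abs_self (Real.sin (π * z))]

theorem exists_integral_inv_weight_le {n N : ℕ} (hn : 1 ≤ n) (hN : n < 2 * N) :
    ∃ A : ℝ, 0 < A ∧ ∀ L : ℝ, 0 < L →
      ∫ x, (1 + ∑ j : Fin n, (L * ‖eChar x (-Pi.single j 1) - 1‖) ^ (2 * N))⁻¹ ∂μT n
        ≤ A * (L ^ n)⁻¹ := by
  have hn' : (0 : ℝ) < n := by exact_mod_cast hn
  set G : ℝ → ℝ := fun u => (1 + |u| ^ (2 * N)) ^ (-(1 / (n : ℝ))) with hG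
  have hGi : Integrable G := integrable_rpow_one_add_pow hn hN
  have hG0 : ∀ u, 0 ≤ G u := fun u => by positivity
  have hGanti : ∀ {u v : ℝ}, 0 ≤ u → u ≤ v → G v ≤ G u := by
    intro u v hu huv
    refine Real.rpow_le_rpow_of_nonpos (by positivity) ?_ (by simp)
    rw [abs_of_nonneg hu, abs_of_nonneg (hu.trans huv)]
    gcongr
  set I := ∫ u, G u with hI
  have hI0 : 0 ≤ I := integral_nonneg hG0
  refine ⟨(I / 2 + 1) ^ n, by positivity, fun L hL => ?_⟩
  set φ : ℝ → ℝ := fun z => G (4 * L * z) + G (4 * L * (1 - z)) with hφ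
  have hi1 : Integrable fun z => G (4 * L * z) := hGi.comp_mul_left' (by positivity)
  have hi2 : Integrable fun z => G (4 * L * (1 - z)) := hi1.comp_sub_left 1
  have hφi : Integrable φ := hi1.add hi2
  have hφ0 : ∀ z, 0 ≤ φ z := fun z => add_nonneg (hG0 _) (hG0 _)
  have hφint : ∫ z in Set.Ico (0 : ℝ) 1, φ z ≤ I / 2 * L⁻¹ := by
    calc ∫ z in Set.Ico (0 : ℝ) 1, φ z ≤ ∫ z, φ z :=
          setIntegral_le_integral hφi (Filter.Eventually.of_forall hφ0)
      _ = I / 2 * L⁻¹ := by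
          rw [hφ, integral_add hi1 hi2,
            integral_sub_left_eq_self (fun z => G (4 * L * z)) volume 1,
            Measure.integral_comp_mul_left, abs_of_pos (by positivity), smul_eq_mul, ← hI]
          field_simp
          ring
  have hpt : ∀ x ∈ cube n,
      (1 + ∑ j : Fin n, (L * ‖eChar x (-Pi.single j 1) - 1‖) ^ (2 * N))⁻¹ ≤ ∏ j, φ (x j) := by
    intro x hx
    have hx' : ∀ j, 0 ≤ x j ∧ x j < 1 := fun j => hx j (Set.mem_univ j)
    set a : Fin n → ℝ := fun j => (L * ‖eChar x (-Pi.single j 1) - 1‖) ^ (2 * N) with ha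
    have ha0 : ∀ j, 0 ≤ a j := fun j => by positivity
    have hS : 0 ≤ ∑ j, a j := Finset.sum_nonneg fun j _ => ha0 j
    have hcard : (1 + ∑ j, a j)⁻¹ = ∏ _j : Fin n, (1 + ∑ j, a j) ^ (-(1 / (n : ℝ))) := by
      rw [Finset.prod_const, Finset.card_univ, Fintype.card_fin, ← Real.rpow_natCast,
        ← Real.rpow_mul (by positivity)]
      rw [show -(1 / (n : ℝ)) * n = -1 by field_simp, Real.rpow_neg_one]
    rw [hcard]
    refine Finset.prod_le_prod (fun j _ => by positivity) fun j _ => ?_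
    have h1 : (1 + ∑ j, a j) ^ (-(1 / (n : ℝ))) ≤ (1 + a j) ^ (-(1 / (n : ℝ))) := by
      refine Real.rpow_le_rpow_of_nonpos (by linarith [ha0 j]) ?_ (by simp)
      gcongr
      exact Finset.single_le_sum (fun i _ => ha0 i) (Finset.mem_univ j)
    have h2 : (1 + a j) ^ (-(1 / (n : ℝ))) = G (L * ‖eChar x (-Pi.single j 1) - 1‖) := by
      rw [hG, ha]
      simp only
      rw [abs_of_nonneg (by positivity)]
    have he : eChar x (-Pi.single j 1) = Complex.exp (2 * (π : ℂ) * Complex.I * (-(x j) : ℂ)) := by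
      rw [eChar]
      congr 2
      rw [Finset.sum_eq_single j]
      · simp
      · intro i _ hi
        simp [Pi.single_eq_of_ne hi]
      · simp
    have h3 := four_mul_min_le_norm_exp_sub_one (hx' j).1 (hx' j).2.le
    rw [← he] at h3
    refine h1.trans (h2.le.trans ?_)
    rcases le_total (x j) (1 - x j) with h | h
    · rw [min_eq_left h] at h3
      have : G (L * ‖eChar x (-Pi.single j 1) - 1‖) ≤ G (4 * L * x j) :=
        hGanti (by have := (hx' j).1; positivity) (by nlinarith)
      exact this.trans (le_add_of_nonneg_right (hG0 _))
    · rw [min_eq_right h] at h3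
      have : G (L * ‖eChar x (-Pi.single j 1) - 1‖) ≤ G (4 * L * (1 - x j)) :=
        hGanti (mul_nonneg (by positivity) (by linarith [(hx' j).2])) (by nlinarith)
      exact this.trans (le_add_of_nonneg_left (hG0 _))
  calc ∫ x, (1 + ∑ j : Fin n, (L * ‖eChar x (-Pi.single j 1) - 1‖) ^ (2 * N))⁻¹ ∂μT n
      ≤ ∫ x, ∏ j, φ (x j) ∂μT n := by
        refine integral_mono_of_nonneg (Filter.Eventually.of_forall fun x => ?_) ?_ ?_
        · exact inv_nonneg.2 (add_nonneg zero_le_one (Finset.sum_nonneg fun j _ => by positivity))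
        · rw [μT_eq_pi]
          exact Integrable.fintype_prod fun _ => hφi.integrableOn
        · exact (ae_restrict_mem (measurableSet_cube n)).mono hpt
    _ = ∏ _j : Fin n, ∫ z in Set.Ico (0 : ℝ) 1, φ z := by
        rw [μT_eq_pi, integral_fintype_prod_eq_prod (f := fun _ => φ)]
    _ ≤ ∏ _j : Fin n, (I / 2 + 1) * L⁻¹ := by
        refine Finset.prod_le_prod (fun _ _ => integral_nonneg hφ0) fun _ _ => hφint.trans ?_
        gcongr
        linarith
    _ = (I / 2 + 1) ^ n * (L ^ n)⁻¹ := by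
        simp [mul_pow]

/-! ### Differences, products and dilations -/

theorem norm_sub_le_of_norm_pd_le {n : ℕ} {j : Fin n} {f : (Fin n → ℝ) → ℂ}
    (hf : ContDiff ℝ (⊤ : ℕ∞) f) {B : ℝ} (hB : ∀ x, ‖pd j f x‖ ≤ B) (x : Fin n → ℝ) :
    ‖f (x + Pi.single j 1) - f x‖ ≤ B := by
  have hd : ∀ t : ℝ, HasDerivAt (fun t : ℝ => f (x + t • Pi.single j 1))
      (pd j f (x + t • Pi.single j 1)) t := fun t => by
    have := hasDerivAt_comp_line hf x (Pi.single j 1) t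
    rwa [Finset.sum_eq_single j (fun i _ hi => by simp [Pi.single_eq_of_ne hi]) (by simp),
      Pi.single_eq_same, Complex.ofReal_one, one_mul] at this
  have := norm_image_sub_le_of_norm_deriv_le_segment_01'
    (f := fun t : ℝ => f (x + t • Pi.single j 1)) (C := B)
    (fun t _ => (hd t).hasDerivWithinAt) (fun t _ => hB _)
  simpa using this

theorem pd_comp_add_sub {n : ℕ} (j : Fin n) {f : (Fin n → ℝ) → ℂ}
    (hf : ContDiff ℝ (⊤ : ℕ∞) f) (v : Fin n → ℝ) :
    pd j (fun x => f (x + v) - f x) = fun x => pd j f (x + v) - pd j f x := by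
  funext x
  have hd : Differentiable ℝ f := hf.differentiable (by simp)
  have hd' : DifferentiableAt ℝ (fun x => f (x + v)) x :=
    (hd _).comp x (differentiableAt_id.add_const v)
  simp only [pd]
  rw [fderiv_fun_sub hd' (hd x), fderiv_comp_add_right]
  rfl

theorem iterate_pd_comp_add_sub {n : ℕ} (j : Fin n) (a : ℕ) {f : (Fin n → ℝ) → ℂ}
    (hf : ContDiff ℝ (⊤ : ℕ∞) f) (v : Fin n → ℝ) :
    (pd j)^[a] (fun x => f (x + v) - f x) = fun x => (pd j)^[a] f (x + v) - (pd j)^[a] f x := by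
  induction a generalizing f with
  | zero => rfl
  | succ a ih =>
    simp only [Function.iterate_succ_apply]
    rw [pd_comp_add_sub j hf v, ih (contDiff_pd j hf)]

theorem norm_iterate_dd_castZ_le {n : ℕ} (j : Fin n) (N : ℕ) {f : (Fin n → ℝ) → ℂ}
    (hf : ContDiff ℝ (⊤ : ℕ∞) f) {B : ℝ} (hB : ∀ x, ‖(pd j)^[N] f x‖ ≤ B) (ξ : Fin n → ℤ) :
    ‖(dd j)^[N] (fun ξ => f (castZ ξ)) ξ‖ ≤ B := by
  induction N generalizing f with
  | zero => exact hB _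
  | succ N ih =>
    rw [Function.iterate_succ_apply]
    have e : dd j (fun ξ => f (castZ ξ)) =
        fun ξ => (fun x => f (x + Pi.single j 1) - f x) (castZ ξ) := by
      funext ξ
      simp only [dd]
      congr 2
      funext i
      by_cases h : i = j
      · subst h; simp [castZ]
      · simp [castZ, Pi.single_eq_of_ne h]
    rw [e]
    have hf' : ContDiff ℝ (⊤ : ℕ∞) fun x => f (x + Pi.single j 1) :=
      hf.comp (contDiff_id.add contDiff_const)
    refine ih (f := fun x => f (x + Pi.single j 1) - f x) (hf'.sub hf) fun x => ?_
    rw [iterate_pd_comp_add_sub j N hf]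
    refine norm_sub_le_of_norm_pd_le (contDiff_iterate_pd j N hf) (fun y => ?_) x
    rw [← Function.iterate_succ_apply' (pd j)]
    exact hB y

theorem iterate_pd_mul {n : ℕ} (j : Fin n) (a : ℕ) {f g : (Fin n → ℝ) → ℂ}
    (hf : ContDiff ℝ (⊤ : ℕ∞) f) (hg : ContDiff ℝ (⊤ : ℕ∞) g) (x : Fin n → ℝ) :
    (pd j)^[a] (fun x => f x * g x) x =
      ∑ i ∈ Finset.range (a + 1), (a.choose i : ℂ) * (pd j)^[i] f x * (pd j)^[a - i] g x := by
  have hl : ∀ {h : (Fin n → ℝ) → ℂ}, ContDiff ℝ (⊤ : ℕ∞) h →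
      ContDiff ℝ (⊤ : ℕ∞) fun t : ℝ => h (x + t • Pi.single j 1) := by
    intro h hh
    exact hh.comp (by fun_prop)
  have key : ∀ {h : (Fin n → ℝ) → ℂ} (i : ℕ), ContDiff ℝ (⊤ : ℕ∞) h →
      (pd j)^[i] h x = iteratedDeriv i (fun t : ℝ => h (x + t • Pi.single j 1)) 0 := by
    intro h i hh
    rw [iteratedDeriv_comp_line_single j i hh x]
    simp
  rw [key a (hf.mul hg)]
  have h1 := iteratedDeriv_fun_mul (n := a) (x := (0 : ℝ))
    (f := fun t : ℝ => f (x + t • Pi.single j 1)) (g := fun t : ℝ => g (x + t • Pi.single j 1))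
    ((hl hf).contDiffAt.of_le (by exact_mod_cast le_top))
    ((hl hg).contDiffAt.of_le (by exact_mod_cast le_top))
  rw [h1]
  exact Finset.sum_congr rfl fun i _ => by rw [key i hf, key (a - i) hg]

theorem iterate_pd_comp_smul {n : ℕ} (j : Fin n) (a : ℕ) {f : (Fin n → ℝ) → ℂ}
    (hf : ContDiff ℝ (⊤ : ℕ∞) f) (s : ℝ) (x : Fin n → ℝ) :
    (pd j)^[a] (fun x => f (s • x)) x = s ^ a • (pd j)^[a] f (s • x) := by
  have h1 := congrFun (iteratedDeriv_comp_line_single j a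
    (f := fun x => f (s • x)) (hf.comp (by fun_prop)) x) 0
  have h2 := congrFun (iteratedDeriv_comp_line_single j a hf (s • x)) 0
  simp only [zero_smul, add_zero] at h1 h2
  rw [← h1, ← h2]
  have e : (fun t : ℝ => f (s • (x + t • Pi.single j 1))) =
      fun t : ℝ => (fun u : ℝ => f (s • x + u • Pi.single j 1)) (s * t) := by
    funext t
    simp only [smul_add, smul_smul]
  have hl : ContDiff ℝ a fun u : ℝ => f (s • x + u • Pi.single j 1) :=
    (hf.comp (by fun_prop : ContDiff ℝ (⊤ : ℕ∞) fun u : ℝ =>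
      s • x + u • (Pi.single j 1 : Fin n → ℝ))).of_le (by exact_mod_cast le_top)
  rw [e, iteratedDeriv_comp_const_smul hl s]
  simp

theorem hasCompactSupport_iterate_pd {n : ℕ} (j : Fin n) (a : ℕ) {f : (Fin n → ℝ) → ℂ}
    (hf : HasCompactSupport f) : HasCompactSupport ((pd j)^[a] f) := by
  induction a generalizing f with
  | zero => exact hf
  | succ a ih => exact ih (hf.fderiv_apply ℝ _)

theorem tsupport_iterate_pd_subset {n : ℕ} (j : Fin n) (a : ℕ) (f : (Fin n → ℝ) → ℂ) :
    tsupport ((pd j)^[a] f) ⊆ tsupport f := by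
  induction a generalizing f with
  | zero => exact subset_rfl
  | succ a ih => exact (ih _).trans (tsupport_fderiv_apply_subset ℝ _)

/-- Localising a symbol with a dilated cutoff preserves the derivative estimates it
satisfies on the support of the cutoff. -/
theorem exists_norm_iterate_pd_mul_dilate_le {n : ℕ} (N : ℕ) {θ : (Fin n → ℝ) → ℂ}
    (hθ : ContDiff ℝ (⊤ : ℕ∞) θ) (hθc : HasCompactSupport θ) :
    ∃ A : ℝ, 0 ≤ A ∧ ∀ (m : (Fin n → ℝ) → ℂ) (L s W : ℝ), ContDiff ℝ (⊤ : ℕ∞) m →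
      0 < L → 0 ≤ s → s * L ≤ 1 → 0 ≤ W →
      (∀ j, ∀ i ≤ N, ∀ ξ, s • ξ ∈ tsupport θ → L ^ i * ‖(pd j)^[i] m ξ‖ ≤ W) →
      ∀ j, ∀ a ≤ N, ∀ ξ, L ^ a * ‖(pd j)^[a] (fun ξ => m ξ * θ (s • ξ)) ξ‖ ≤ A * W := by
  have hb : ∀ q : Fin n × ℕ, ∃ A, ∀ ξ, ‖(pd q.1)^[q.2] θ ξ‖ ≤ A := fun q =>
    (contDiff_iterate_pd q.1 q.2 hθ).continuous.bounded_above_of_compact_support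
      (hasCompactSupport_iterate_pd q.1 q.2 hθc)
  choose A₀ hA₀ using hb
  set A₁ := ∑ q ∈ Finset.univ ×ˢ Finset.range (N + 1), |A₀ q| with hA₁
  have hA₁0 : 0 ≤ A₁ := Finset.sum_nonneg fun _ _ => abs_nonneg _
  have hle : ∀ j, ∀ i ≤ N, ∀ ξ, ‖(pd j)^[i] θ ξ‖ ≤ A₁ := fun j i hi ξ =>
    (hA₀ (j, i) ξ).trans ((le_abs_self _).trans
      (Finset.single_le_sum (f := fun q => |A₀ q|) (fun _ _ => abs_nonneg _)
        (by simp; omega : (j, i) ∈ Finset.univ ×ˢ Finset.range (N + 1))))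
  refine ⟨2 ^ N * A₁, by positivity, fun m L s W hm hL hs hsL hW h j a ha ξ => ?_⟩
  have hθs : ContDiff ℝ (⊤ : ℕ∞) fun ξ => θ (s • ξ) := hθ.comp (by fun_prop)
  rw [iterate_pd_mul j a hm hθs]
  calc L ^ a * ‖∑ i ∈ Finset.range (a + 1), (a.choose i : ℂ) * (pd j)^[i] m ξ *
          (pd j)^[a - i] (fun ξ => θ (s • ξ)) ξ‖
      ≤ L ^ a * ∑ i ∈ Finset.range (a + 1), ‖(a.choose i : ℂ) * (pd j)^[i] m ξ *
          (pd j)^[a - i] (fun ξ => θ (s • ξ)) ξ‖ := by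
        gcongr
        exact norm_sum_le _ _
    _ ≤ ∑ i ∈ Finset.range (a + 1), (a.choose i : ℝ) * (W * A₁) := by
        rw [Finset.mul_sum]
        refine Finset.sum_le_sum fun i hi => ?_
        have hia : i ≤ a := by simpa [Nat.lt_succ_iff] using hi
        rw [iterate_pd_comp_smul j _ hθ, norm_mul, norm_mul, Complex.norm_natCast, norm_smul,
          norm_pow, Real.norm_of_nonneg hs]
        by_cases hsupp : s • ξ ∈ tsupport θ
        · calc L ^ a * (a.choose i * ‖(pd j)^[i] m ξ‖ * (s ^ (a - i) * ‖(pd j)^[a - i] θ (s • ξ)‖))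
              = a.choose i * ((L ^ i * ‖(pd j)^[i] m ξ‖) *
                  ((s * L) ^ (a - i) * ‖(pd j)^[a - i] θ (s • ξ)‖)) := by
                rw [mul_pow]
                have : L ^ a = L ^ i * L ^ (a - i) := by rw [← pow_add]; congr 1; omega
                rw [this]
                ring
            _ ≤ a.choose i * (W * (1 * A₁)) := by
                gcongr
                · exact h j i (hia.trans ha) ξ hsupp
                · exact pow_le_one₀ (by positivity) hsL
                · exact hle j _ (by omega) _
            _ = _ := by rw [one_mul]
        · have : (pd j)^[a - i] θ (s • ξ) = 0 :=
            image_eq_zero_of_notMem_tsupport fun h' =>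
              hsupp (tsupport_iterate_pd_subset j _ θ h')
          rw [this, norm_zero, mul_zero, mul_zero, mul_zero]
          positivity
    _ = 2 ^ a * (W * A₁) := by
        rw [← Finset.sum_mul]
        congr 1
        exact_mod_cast Nat.sum_range_choose a
    _ ≤ 2 ^ N * (W * A₁) := by
        gcongr
        exact one_le_two
    _ = 2 ^ N * A₁ * W := by ring

/-! ### Dyadic cutoffs -/

/-- A smooth bump which is `1` on the unit ball and supported in the ball of radius `2`. -/
def cutoffBump (n : ℕ) : ContDiffBump (0 : Fin n → ℝ) where
  rIn := 1
  rOut := 2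
  rIn_pos := one_pos
  rIn_lt_rOut := one_lt_two

/-- The complex-valued smooth cutoff to the ball of radius `2`. -/
def cutoff (n : ℕ) (ξ : Fin n → ℝ) : ℂ := (cutoffBump n ξ : ℂ)

theorem contDiff_cutoff (n : ℕ) : ContDiff ℝ (⊤ : ℕ∞) (cutoff n) :=
  Complex.ofRealCLM.contDiff.comp (cutoffBump n).contDiff

theorem cutoff_eq_one {n : ℕ} {ξ : Fin n → ℝ} (h : ‖ξ‖ ≤ 1) : cutoff n ξ = 1 := by
  rw [cutoff, (cutoffBump n).one_of_mem_closedBall (by simpa [cutoffBump] using h),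
    Complex.ofReal_one]

theorem cutoff_eq_zero {n : ℕ} {ξ : Fin n → ℝ} (h : 2 ≤ ‖ξ‖) : cutoff n ξ = 0 := by
  rw [cutoff, (cutoffBump n).zero_of_le_dist (by simpa [cutoffBump] using h),
    Complex.ofReal_zero]

theorem norm_cutoff_le_one {n : ℕ} (ξ : Fin n → ℝ) : ‖cutoff n ξ‖ ≤ 1 := by
  rw [cutoff, Complex.norm_real, Real.norm_of_nonneg (cutoffBump n).nonneg]
  exact (cutoffBump n).le_one

/-- The profile of the `k`-th dyadic block: a ball for `k = 0`, an annulus otherwise. -/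
def dyadicProfile (n k : ℕ) (ξ : Fin n → ℝ) : ℂ :=
  if k = 0 then cutoff n ξ else cutoff n ξ - cutoff n ((2 : ℝ) • ξ)

theorem contDiff_dyadicProfile (n k : ℕ) : ContDiff ℝ (⊤ : ℕ∞) (dyadicProfile n k) := by
  have h := contDiff_cutoff n
  have h2 : ContDiff ℝ (⊤ : ℕ∞) fun ξ => cutoff n ((2 : ℝ) • ξ) := h.comp (by fun_prop)
  unfold dyadicProfile
  split_ifs
  · exact h
  · exact h.sub h2

theorem tsupport_dyadicProfile_subset (n k : ℕ) :
    tsupport (dyadicProfile n k) ⊆ Metric.closedBall 0 2 := by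
  refine closure_minimal (fun ξ hξ => ?_) Metric.isClosed_closedBall
  by_contra h
  simp only [Metric.mem_closedBall, dist_zero_right, not_le] at h
  refine hξ ?_
  have h2 : 2 ≤ ‖(2 : ℝ) • ξ‖ := by rw [norm_smul, Real.norm_two]; linarith
  simp [dyadicProfile, cutoff_eq_zero h.le, cutoff_eq_zero h2]

theorem hasCompactSupport_dyadicProfile (n k : ℕ) : HasCompactSupport (dyadicProfile n k) :=
  (isCompact_closedBall _ _).of_isClosed_subset (isClosed_tsupport _)
    (tsupport_dyadicProfile_subset n k)

theorem half_le_norm_of_mem_tsupport_dyadicProfile {n k : ℕ} (hk : k ≠ 0) {ξ : Fin n → ℝ}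
    (hξ : ξ ∈ tsupport (dyadicProfile n k)) : 1 / 2 ≤ ‖ξ‖ := by
  have : tsupport (dyadicProfile n k) ⊆ {ξ | 1 / 2 ≤ ‖ξ‖} := by
    refine closure_minimal (fun ξ hξ => ?_) (isClosed_le continuous_const continuous_norm)
    by_contra h
    simp only [Set.mem_ofPred_eq, not_le] at h
    refine hξ ?_
    have h2 : ‖(2 : ℝ) • ξ‖ ≤ 1 := by rw [norm_smul, Real.norm_two]; linarith
    simp [dyadicProfile, hk, cutoff_eq_one (show ‖ξ‖ ≤ 1 by linarith), cutoff_eq_one h2]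
  exact this hξ

theorem sum_dyadicProfile (n K : ℕ) (ξ : Fin n → ℝ) :
    ∑ k ∈ Finset.range (K + 1), dyadicProfile n k (((2 : ℝ) ^ k)⁻¹ • ξ) =
      cutoff n (((2 : ℝ) ^ K)⁻¹ • ξ) := by
  induction K with
  | zero => simp [dyadicProfile]
  | succ K ih =>
    rw [Finset.sum_range_succ, ih, dyadicProfile, if_neg (Nat.succ_ne_zero K), smul_smul]
    rw [show (2 : ℝ) * (2 ^ (K + 1))⁻¹ = (2 ^ K)⁻¹ by rw [pow_succ]; field_simp]
    ring

theorem dyadicProfile_eq_of_ne_zero {n k : ℕ} (hk : k ≠ 0) :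
    dyadicProfile n k = dyadicProfile n 1 := by
  funext ξ
  simp [dyadicProfile, hk]

/-! ### Kernels of dyadic blocks -/

theorem exists_sum_comp_pow_succ_le {ω : ℝ → ℝ} (hω_nonneg : ∀ t, 0 ≤ t → 0 ≤ ω t)
    (hω_mono : MonotoneOn ω (Set.Ici (0 : ℝ)))
    (hω_int : IntegrableOn (fun t => ω t * t⁻¹) (Set.Ioc (0 : ℝ) 1) volume)
    {q : ℝ} (hq0 : 0 < q) (hq1 : q < 1) :
    ∃ S : ℝ, 0 ≤ S ∧ ∀ K : ℕ, ∑ k ∈ Finset.range K, ω (q ^ (k + 1)) ≤ S := by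
  have hpos : ∀ k : ℕ, 0 < q ^ k := fun k => pow_pos hq0 k
  have hsub : ∀ k : ℕ, Set.Ioc (q ^ k) 1 ⊆ Set.Ioc (0 : ℝ) 1 := fun k =>
    Set.Ioc_subset_Ioc_left (hpos k).le
  have hnn : 0 ≤ᵐ[volume.restrict (Set.Ioc (0 : ℝ) 1)] fun t => ω t * t⁻¹ :=
    (ae_restrict_mem measurableSet_Ioc).mono fun t ht =>
      mul_nonneg (hω_nonneg t ht.1.le) (inv_nonneg.2 ht.1.le)
  have key : ∀ K : ℕ, (1 - q) * ∑ k ∈ Finset.range K, ω (q ^ (k + 1)) ≤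
      ∫ t in Set.Ioc (q ^ K) 1, ω t * t⁻¹ := by
    intro K
    induction K with
    | zero => simp
    | succ K ih =>
      have hle : q ^ (K + 1) ≤ q ^ K := pow_le_pow_of_le_one hq0.le hq1.le (Nat.le_succ K)
      have hle1 : q ^ K ≤ 1 := pow_le_one₀ hq0.le hq1.le
      have hi1 : IntegrableOn (fun t => ω t * t⁻¹) (Set.Ioc (q ^ (K + 1)) (q ^ K)) :=
        hω_int.mono_set (Set.Ioc_subset_Ioc (hpos _).le hle1)
      have hi2 : IntegrableOn (fun t => ω t * t⁻¹) (Set.Ioc (q ^ K) 1) :=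
        hω_int.mono_set (hsub K)
      rw [Finset.sum_range_succ, mul_add, ← Set.Ioc_union_Ioc_eq_Ioc hle hle1,
        setIntegral_union (Set.Ioc_disjoint_Ioc_of_le le_rfl) measurableSet_Ioc hi1 hi2, add_comm]
      refine add_le_add ?_ ih
      calc (1 - q) * ω (q ^ (K + 1))
          = ∫ _t in Set.Ioc (q ^ (K + 1)) (q ^ K), ω (q ^ (K + 1)) * (q ^ K)⁻¹ := by
            rw [setIntegral_const, measureReal_def, Real.volume_Ioc,
              ENNReal.toReal_ofReal (by linarith), smul_eq_mul, pow_succ]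
            have := (hpos K).ne'
            field_simp
        _ ≤ _ := by
            refine setIntegral_mono_on (integrableOn_const (by simp)) hi1
              measurableSet_Ioc fun t ht => ?_
            have ht0 : 0 < t := (hpos _).trans ht.1
            gcongr
            · exact hω_nonneg _ ht0.le
            · exact hω_mono (hpos _).le ht0.le ht.1.le
            · exact ht.2
  have h1q : 0 < 1 - q := by linarith
  refine ⟨(1 - q)⁻¹ * ∫ t in Set.Ioc (0 : ℝ) 1, ω t * t⁻¹,
    mul_nonneg (by positivity) (integral_nonneg_of_ae hnn), fun K => ?_⟩
  rw [← div_eq_inv_mul, le_div_iff₀ h1q, mul_comm]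
  exact (key K).trans (setIntegral_mono_set hω_int hnn (hsub K).eventuallyLE)

theorem norm_le_jbR {n : ℕ} (ξ : Fin n → ℝ) : ‖ξ‖ ≤ jbR ξ := by
  refine (pi_norm_le_iff_of_nonneg (Real.sqrt_nonneg _)).2 fun j => ?_
  rw [Real.norm_eq_abs]
  refine Real.abs_le_sqrt ?_
  have := Finset.single_le_sum (f := fun i => ξ i ^ 2) (fun i _ => sq_nonneg _)
    (Finset.mem_univ j)
  linarith

theorem one_le_jbR {n : ℕ} (ξ : Fin n → ℝ) : 1 ≤ jbR ξ := by
  refine Real.one_le_sqrt.2 ?_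
  have : 0 ≤ ∑ j, ξ j ^ 2 := Finset.sum_nonneg fun i _ => sq_nonneg _
  linarith

/-- The symbol of the `k`-th dyadic block of a multiplier, on the lattice. -/
def dyadicBlock {n : ℕ} (k : ℕ) (m : (Fin n → ℝ) → ℂ) (ξ : Fin n → ℤ) : ℂ :=
  m (castZ ξ) * dyadicProfile n k (((2 : ℝ) ^ k)⁻¹ • castZ ξ)

theorem dyadicBlock_eq_zero {n k : ℕ} (m : (Fin n → ℝ) → ℂ) {ξ : Fin n → ℤ}
    (hξ : ξ ∉ latticeBox n (2 ^ (k + 1))) : dyadicBlock k m ξ = 0 := by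
  rw [dyadicBlock]
  by_contra h
  refine hξ (mem_latticeBox.2 fun j => ?_)
  have hmem : ((2 : ℝ) ^ k)⁻¹ • castZ ξ ∈ tsupport (dyadicProfile n k) :=
    subset_tsupport _ (right_ne_zero_of_mul h)
  have hn := tsupport_dyadicProfile_subset n k hmem
  rw [Metric.mem_closedBall, dist_zero_right, norm_smul, norm_inv, norm_pow, Real.norm_two,
    inv_mul_le_iff₀ (by positivity)] at hn
  have h1 : |((ξ j : ℤ) : ℝ)| ≤ 2 ^ k * 2 := (norm_le_pi_norm (castZ ξ) j).trans hn
  rw [← pow_succ] at h1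
  exact_mod_cast h1

theorem sum_dyadicBlock {n : ℕ} (K : ℕ) (m : (Fin n → ℝ) → ℂ) (ξ : Fin n → ℤ) :
    ∑ k ∈ Finset.range (K + 1), dyadicBlock k m ξ =
      m (castZ ξ) * cutoff n (((2 : ℝ) ^ K)⁻¹ • castZ ξ) := by
  simp only [dyadicBlock]
  rw [← Finset.mul_sum, sum_dyadicProfile]

/-- `L¹` bound for the kernel of a dyadic block, from derivative bounds in the region where
the block lives. -/
theorem exists_integral_norm_dyadicBlock_kernel_sq_le {n N : ℕ} (hn : 1 ≤ n) (hN : n < 2 * N) :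
    ∃ A : ℝ, 0 ≤ A ∧ ∀ (k : ℕ) (m : (Fin n → ℝ) → ℂ) (L W : ℝ), ContDiff ℝ (⊤ : ℕ∞) m →
      0 < L → L ≤ 2 ^ (k - 1) → 0 ≤ W →
      (∀ j, ∀ i ≤ N, ∀ ξ, 2 ^ (k - 1) ≤ jbR ξ → L ^ i * ‖(pd j)^[i] m ξ‖ ≤ W) →
      (∫ x, ‖∑' ξ, dyadicBlock k m ξ * eChar x ξ‖ ∂μT n) ^ 2 ≤
        A * ((2 ^ (k - 1)) ^ n * W ^ 2 * (L ^ n)⁻¹) := by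
  obtain ⟨Y, hY0, hY⟩ := exists_integral_inv_weight_le hn hN
  obtain ⟨A₀, hA₀, h₀⟩ := exists_norm_iterate_pd_mul_dilate_le N
    (contDiff_dyadicProfile n 0) (hasCompactSupport_dyadicProfile n 0)
  obtain ⟨A₁, hA₁, h₁⟩ := exists_norm_iterate_pd_mul_dilate_le N
    (contDiff_dyadicProfile n 1) (hasCompactSupport_dyadicProfile n 1)
  refine ⟨(n + 1) * (9 + 2 * N) ^ n * (A₀ + A₁) ^ 2 * Y, by positivity,
    fun k m L W hm hL hLk hW h => ?_⟩
  have hs : ((2 : ℝ) ^ k)⁻¹ * L ≤ 1 := by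
    rw [inv_mul_le_iff₀ (by positivity), mul_one]
    exact hLk.trans (pow_le_pow_right₀ one_le_two (Nat.sub_le _ _))
  have hsupp : ∀ ξ : Fin n → ℝ, ((2 : ℝ) ^ k)⁻¹ • ξ ∈ tsupport (dyadicProfile n k) →
      2 ^ (k - 1) ≤ jbR ξ := by
    intro ξ hξ
    rcases Nat.eq_zero_or_pos k with rfl | hk
    · simpa using one_le_jbR ξ
    · have h2 := half_le_norm_of_mem_tsupport_dyadicProfile hk.ne' hξ
      rw [norm_smul, norm_inv, norm_pow, Real.norm_two, le_inv_mul_iff₀ (by positivity)] at h2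
      obtain ⟨l, rfl⟩ := Nat.exists_eq_succ_of_ne_zero hk.ne'
      refine le_trans (le_of_eq ?_) (h2.trans (norm_le_jbR ξ))
      simp [pow_succ]
  have hbd : ∀ j, ∀ a ≤ N, ∀ ξ, L ^ a *
      ‖(pd j)^[a] (fun ξ => m ξ * dyadicProfile n k (((2 : ℝ) ^ k)⁻¹ • ξ)) ξ‖ ≤
        (A₀ + A₁) * W := by
    intro j a ha ξ
    rcases eq_or_ne k 0 with rfl | hk
    · refine (h₀ m L _ W hm hL (by positivity) hs hW
        (fun j i hi ξ hξ => h j i hi ξ (hsupp ξ hξ)) j a ha ξ).trans ?_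
      gcongr
      linarith
    · rw [dyadicProfile_eq_of_ne_zero hk] at hsupp ⊢
      refine (h₁ m L _ W hm hL (by positivity) hs hW
        (fun j i hi ξ hξ => h j i hi ξ (hsupp ξ hξ)) j a ha ξ).trans ?_
      gcongr
      linarith
  have hsm : ContDiff ℝ (⊤ : ℕ∞) fun ξ => m ξ * dyadicProfile n k (((2 : ℝ) ^ k)⁻¹ • ξ) :=
    hm.mul ((contDiff_dyadicProfile n k).comp (by fun_prop))
  have j₀ : Fin n := ⟨0, hn⟩
  have hB : ∀ ξ, ‖dyadicBlock k m ξ‖ ≤ (A₀ + A₁) * W := fun ξ => by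
    simpa [dyadicBlock] using hbd j₀ 0 (Nat.zero_le _) (castZ ξ)
  have hBN : ∀ j ξ, L ^ N * ‖(dd j)^[N] (dyadicBlock k m) ξ‖ ≤ (A₀ + A₁) * W := by
    intro j ξ
    rw [← le_div_iff₀' (by positivity)]
    refine norm_iterate_dd_castZ_le j N hsm (fun x => ?_) ξ
    rw [le_div_iff₀' (by positivity)]
    exact hbd j N le_rfl x
  have hfin := integral_norm_tsum_eChar_sq_le (fun ξ hξ => dyadicBlock_eq_zero m hξ) hL
    (by positivity) hB hBN (hY L hL)
  refine hfin.trans ?_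
  have hR : (2 * ((2 ^ (k + 1) : ℕ) + N) + 1 : ℝ) ≤ (9 + 2 * N) * 2 ^ (k - 1) := by
    have h1 : (1 : ℝ) ≤ 2 ^ (k - 1) := one_le_pow₀ one_le_two
    have h2 : (2 : ℝ) ^ (k + 1) ≤ 4 * 2 ^ (k - 1) := by
      rw [show (4 : ℝ) = 2 ^ 2 by norm_num, ← pow_add]
      exact pow_le_pow_right₀ one_le_two (by omega)
    push_cast
    nlinarith [mul_le_mul_of_nonneg_left h1 (Nat.cast_nonneg (α := ℝ) N)]
  calc _ ≤ (n + 1) * ((9 + 2 * N) * 2 ^ (k - 1)) ^ n * ((A₀ + A₁) * W) ^ 2 * (Y * (L ^ n)⁻¹) := by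
        gcongr
    _ = _ := by rw [mul_pow, mul_pow]; ring

/-! ### Young's inequality on the torus -/

theorem rpow_lintegral_mul_le {β : Type*} [MeasurableSpace β] {ν : Measure β} {k g : β → ℝ≥0∞}
    (hk : Measurable k) (hg : Measurable g) {p : ℝ} (hp : 1 ≤ p) :
    (∫⁻ y, k y * g y ∂ν) ^ p ≤ (∫⁻ y, k y ∂ν) ^ (p - 1) * ∫⁻ y, k y * g y ^ p ∂ν := by
  rcases hp.eq_or_lt with rfl | hp1
  · simp
  have hpq := Real.HolderConjugate.conjExponent hp1
  set q := Real.conjExponent p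
  have hp0 : 0 < p := hpq.pos
  have hq0 : 0 < q := hpq.symm.pos
  have e : ∀ y, k y * g y = ((fun y => k y ^ (1 / p) * g y) * fun y => k y ^ (1 / q)) y := by
    intro y
    simp only [Pi.mul_apply]
    rw [mul_right_comm, ← ENNReal.rpow_add_of_nonneg _ _ (by positivity) (by positivity),
      one_div, one_div, hpq.inv_add_inv_eq_one, ENNReal.rpow_one]
  calc (∫⁻ y, k y * g y ∂ν) ^ p
      ≤ ((∫⁻ y, (k y ^ (1 / p) * g y) ^ p ∂ν) ^ (1 / p) *
          (∫⁻ y, (k y ^ (1 / q)) ^ q ∂ν) ^ (1 / q)) ^ p := by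
        refine ENNReal.rpow_le_rpow ?_ hp0.le
        simp only [e]
        exact ENNReal.lintegral_mul_le_Lp_mul_Lq ν hpq
          ((hk.pow_const _).mul hg).aemeasurable (hk.pow_const _).aemeasurable
    _ = _ := by
        rw [ENNReal.mul_rpow_of_nonneg _ _ hp0.le, ← ENNReal.rpow_mul, ← ENNReal.rpow_mul,
          one_div_mul_cancel hp0.ne', ENNReal.rpow_one, mul_comm]
        congr 1
        · rw [show 1 / q * p = p - 1 by
            have := hpq.inv_add_inv_eq_one
            field_simp at this ⊢
            linarith]
          simp only [← ENNReal.rpow_mul, one_div_mul_cancel hq0.ne', ENNReal.rpow_one]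
        · refine lintegral_congr fun y => ?_
          rw [ENNReal.mul_rpow_of_nonneg _ _ hp0.le, ← ENNReal.rpow_mul,
            one_div_mul_cancel hp0.ne', ENNReal.rpow_one]

/-- Schur's test. -/
theorem lintegral_rpow_lintegral_mul_le {α β : Type*} [MeasurableSpace α] [MeasurableSpace β]
    {μ : Measure α} {ν : Measure β} [SFinite μ] [SFinite ν] {k : α → β → ℝ≥0∞}
    (hk : Measurable (Function.uncurry k)) {g : β → ℝ≥0∞} (hg : Measurable g) {p : ℝ}
    (hp : 1 ≤ p) {κ : ℝ≥0∞} (h1 : ∀ x, ∫⁻ y, k x y ∂ν ≤ κ) (h2 : ∀ y, ∫⁻ x, k x y ∂μ ≤ κ) :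
    ∫⁻ x, (∫⁻ y, k x y * g y ∂ν) ^ p ∂μ ≤ κ ^ p * ∫⁻ y, g y ^ p ∂ν := by
  have hkx : ∀ x, Measurable (k x) := fun x => hk.comp measurable_prodMk_left
  have hky : ∀ y, Measurable fun x => k x y := fun y => hk.comp measurable_prodMk_right
  have hm : Measurable (Function.uncurry fun x y => k x y * g y ^ p) :=
    hk.mul ((hg.comp measurable_snd).pow_const p)
  calc ∫⁻ x, (∫⁻ y, k x y * g y ∂ν) ^ p ∂μ
      ≤ ∫⁻ x, κ ^ (p - 1) * ∫⁻ y, k x y * g y ^ p ∂ν ∂μ := by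
        refine lintegral_mono fun x => (rpow_lintegral_mul_le (hkx x) hg hp).trans ?_
        gcongr
        exact h1 x
    _ = κ ^ (p - 1) * ∫⁻ y, ∫⁻ x, k x y * g y ^ p ∂μ ∂ν := by
        rw [lintegral_const_mul _ hm.lintegral_prod_right, lintegral_lintegral_swap hm.aemeasurable]
    _ ≤ κ ^ (p - 1) * ∫⁻ y, κ * g y ^ p ∂ν := by
        gcongr with y
        rw [lintegral_mul_const _ (hky y)]
        gcongr
        exact h2 y
    _ = κ ^ p * ∫⁻ y, g y ^ p ∂ν := by
        rw [lintegral_const_mul _ (hg.pow_const p), ← mul_assoc]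
        congr 1
        conv_lhs => rw [← ENNReal.rpow_one κ, ← ENNReal.rpow_mul, one_mul]
        rw [← ENNReal.rpow_add_of_nonneg _ _ (by linarith) zero_le_one, sub_add_cancel]

open scoped Pointwise in
theorem lintegral_add_right_μT {n : ℕ} {g : (Fin n → ℝ) → ℝ≥0∞}
    (hg : ∀ x (v : Fin n → ℤ), g (x + fun j => (v j : ℝ)) = g x) (y : Fin n → ℝ) :
    ∫⁻ x, g (x + y) ∂μT n = ∫⁻ x, g x ∂μT n := by
  have hF := ZSpan.isAddFundamentalDomain (Pi.basisFun ℝ (Fin n)) volume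
  have hc : ZSpan.fundamentalDomain (Pi.basisFun ℝ (Fin n)) = cube n :=
    ZSpan.fundamentalDomain_pi_basisFun
  rw [hc] at hF
  have h1 : ∫⁻ x, g (x + y) ∂μT n = ∫⁻ x in y +ᵥ cube n, g x := by
    have := (measurePreserving_add_right (volume : Measure (Fin n → ℝ)) y).setLIntegral_comp_emb
      (measurableEmbedding_addRight y) g (cube n)
    rw [μT, this]
    congr 2
    ext z
    simp only [Set.mem_vadd_set, Set.mem_image, vadd_eq_add, add_comm y]
  rw [h1]
  have : VAddInvariantMeasure (Submodule.span ℤ (Set.range (Pi.basisFun ℝ (Fin n))))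
      (Fin n → ℝ) volume := inferInstanceAs <| VAddInvariantMeasure
    (Submodule.span ℤ (Set.range (Pi.basisFun ℝ (Fin n)))).toAddSubgroup (Fin n → ℝ) volume
  refine IsAddFundamentalDomain.setLIntegral_eq (hF.vadd_of_comm y) hF g fun w x => ?_
  have hw := (Pi.basisFun ℝ (Fin n)).mem_span_iff_repr_mem ℤ (w : Fin n → ℝ) |>.1 w.2
  choose v hv using hw
  rw [Submodule.vadd_def, vadd_eq_add, add_comm, ← hg x v]
  congr 2
  funext j
  simpa using (hv j).symm

theorem lintegral_neg_μT {n : ℕ} {g : (Fin n → ℝ) → ℝ≥0∞}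
    (hg : ∀ x (v : Fin n → ℤ), g (x + fun j => (v j : ℝ)) = g x) :
    ∫⁻ x, g (-x) ∂μT n = ∫⁻ x, g x ∂μT n := by
  have hc : μT n = volume.restrict (Set.Icc (0 : Fin n → ℝ) 1) :=
    Measure.restrict_congr_set (Measure.univ_pi_Ico_ae_eq_Icc (μ := fun _ => volume))
  have h1 : ∀ x, g (-x) = g (1 - x) := by
    intro x
    rw [← hg (-x) 1]
    congr 1
    funext j
    simp [sub_eq_neg_add]
  simp only [h1]
  rw [hc]
  have :=
    (Measure.measurePreserving_sub_left (volume : Measure (Fin n → ℝ)) 1).setLIntegral_comp_preimage_emb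
    (measurableEmbedding_subLeft 1) g (Set.Icc (0 : Fin n → ℝ) 1)
  rw [← this]
  congr 2
  ext z
  simp

theorem periodic_tsum_eChar {n : ℕ} (c : (Fin n → ℤ) → ℂ) (x : Fin n → ℝ) (v : Fin n → ℤ) :
    ∑' ξ, c ξ * eChar (x + fun j => (v j : ℝ)) ξ = ∑' ξ, c ξ * eChar x ξ := by
  simp only [eChar_add_left, eChar_intCast, mul_one]

theorem eLpNorm_sum_eChar_mul_fc_le {n M : ℕ} {c : (Fin n → ℤ) → ℂ}
    (hc : ∀ ξ, ξ ∉ latticeBox n M → c ξ = 0) {p : ℝ} (hp : 1 ≤ p) {f : (Fin n → ℝ) → ℂ}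
    (hf : Continuous f) {A : ℝ} (hA : ∫ x, ‖∑' ξ, c ξ * eChar x ξ‖ ∂μT n ≤ A) :
    eLpNorm (fun x => ∑ ξ ∈ latticeBox n M, eChar x ξ * c ξ * fc f ξ) (ENNReal.ofReal p) (μT n) ≤
      ENNReal.ofReal A * eLpNorm f (ENNReal.ofReal p) (μT n) := by
  set K : (Fin n → ℝ) → ℂ := fun x => ∑' ξ, c ξ * eChar x ξ with hK
  have hKc : Continuous K := continuous_tsum_eChar hc
  have hKp : ∀ x (v : Fin n → ℤ), ‖K (x + fun j => (v j : ℝ))‖ₑ = ‖K x‖ₑ := fun x v => by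
    simp only [hK, periodic_tsum_eChar]
  have hA' : ∫⁻ x, ‖K x‖ₑ ∂μT n ≤ ENNReal.ofReal A := by
    rw [← ofReal_integral_norm_eq_lintegral_enorm hKc.integrable_μT]
    exact ENNReal.ofReal_le_ofReal hA
  have hT : ∀ x, ∑ ξ ∈ latticeBox n M, eChar x ξ * c ξ * fc f ξ = ∫ y, K (x - y) * f y ∂μT n := by
    intro x
    have h1 : ∀ ξ, eChar x ξ * c ξ * fc f ξ = ∫ y, c ξ * eChar (x - y) ξ * f y ∂μT n := by
      intro ξ
      rw [fc, ← integral_const_mul]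
      refine integral_congr_ae (Filter.Eventually.of_forall fun y => ?_)
      simp only
      rw [← eChar_neg_left, sub_eq_add_neg, eChar_add_left]
      ring
    simp only [h1]
    rw [← integral_finsetSum _ fun ξ _ => by
      refine Continuous.integrable_μT ?_
      fun_prop]
    refine integral_congr_ae (Filter.Eventually.of_forall fun y => ?_)
    simp only [hK, tsum_mul_eChar_eq_sum hc, Finset.sum_mul]
  simp only [hT]
  have hp0 : 0 < p := by linarith
  have hp0' : ENNReal.ofReal p ≠ 0 := by simpa using hp0
  rw [eLpNorm_eq_lintegral_rpow_enorm_toReal hp0' ENNReal.ofReal_ne_top,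
    eLpNorm_eq_lintegral_rpow_enorm_toReal hp0' ENNReal.ofReal_ne_top,
    ENNReal.toReal_ofReal hp0.le]
  have h2 : ∫⁻ x, ‖∫ y, K (x - y) * f y ∂μT n‖ₑ ^ p ∂μT n ≤
      ENNReal.ofReal A ^ p * ∫⁻ y, ‖f y‖ₑ ^ p ∂μT n := by
    refine le_trans (lintegral_mono fun x => ?_)
      (lintegral_rpow_lintegral_mul_le (μ := μT n) (ν := μT n) (k := fun x y => ‖K (x - y)‖ₑ)
        (g := fun y => ‖f y‖ₑ) ?_ ?_ hp (fun x => ?_) fun y => ?_)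
    · refine ENNReal.rpow_le_rpow ((enorm_integral_le_lintegral_enorm _).trans ?_) hp0.le
      simp only [enorm_mul]
      exact le_rfl
    · exact (hKc.comp (continuous_fst.sub continuous_snd)).enorm.measurable
    · exact hf.enorm.measurable
    · refine le_trans (le_of_eq ?_) hA'
      rw [← lintegral_neg_μT (g := fun y => ‖K y‖ₑ) hKp,
        ← lintegral_add_right_μT (g := fun y => ‖K (-y)‖ₑ) _ (-x)]
      · refine lintegral_congr fun y => ?_
        congr 2
        abel
      · intro z v
        rw [← hKp _ v]
        congr 2
        abel
    · refine le_trans (le_of_eq ?_) hA'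
      simp only [sub_eq_add_neg]
      exact lintegral_add_right_μT (g := fun y => ‖K y‖ₑ) hKp (-y)
  calc _ ≤ (ENNReal.ofReal A ^ p * ∫⁻ y, ‖f y‖ₑ ^ p ∂μT n) ^ (1 / p) :=
        ENNReal.rpow_le_rpow h2 (by positivity)
    _ = _ := by
        rw [ENNReal.mul_rpow_of_nonneg _ _ (by positivity), ← ENNReal.rpow_mul,
          mul_one_div_cancel hp0.ne', ENNReal.rpow_one]

/-! ### Truncated multipliers -/

theorem mul_cutoff_eq_zero {n K : ℕ} (m : (Fin n → ℝ) → ℂ) {ξ : Fin n → ℤ}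
    (hξ : ξ ∉ latticeBox n (2 ^ (K + 1))) :
    m (castZ ξ) * cutoff n (((2 : ℝ) ^ K)⁻¹ • castZ ξ) = 0 := by
  rw [← sum_dyadicBlock]
  refine Finset.sum_eq_zero fun k hk => dyadicBlock_eq_zero m fun h => hξ ?_
  refine latticeBox_mono (Nat.pow_le_pow_right two_pos ?_) h
  rw [Finset.mem_range] at hk
  omega

/-- Multipliers satisfying the `ω`-type estimates are bounded on `L^p` after truncation to
frequencies of size at most `2^K`, uniformly in `K`. -/
theorem exists_eLpNorm_truncated_multiplier_le {n : ℕ} (hn : 1 ≤ n) {ε ρ : ℝ}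
    (hε0 : 0 < ε) (hρ0 : 0 ≤ ρ) (hρ1 : ρ ≤ 1) {ω : ℝ → ℝ} (hω_nonneg : ∀ t, 0 ≤ t → 0 ≤ ω t)
    (hω_mono : MonotoneOn ω (Set.Ici (0 : ℝ)))
    (hω_int : IntegrableOn (fun t => ω t * t⁻¹) (Set.Ioc (0 : ℝ) 1) volume)
    {C : ℝ} (hC : 0 ≤ C) :
    ∃ A : ℝ, ∀ m : (Fin n → ℝ) → ℂ, ContDiff ℝ (⊤ : ℕ∞) m →
      (∀ j, ∀ i ≤ n / 2 + 1, ∀ ξ, ‖(pd j)^[i] m ξ‖ ≤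
        C * ω (jbR ξ ^ (-ε)) * jbR ξ ^ (-((n : ℝ) / 2) * (1 - ρ) - ρ * i)) →
      ∀ (K : ℕ) (p : ℝ), 1 ≤ p → ∀ f : (Fin n → ℝ) → ℂ, Continuous f →
        eLpNorm (fun x => ∑ ξ ∈ latticeBox n (2 ^ (K + 1)), eChar x ξ *
          (m (castZ ξ) * cutoff n (((2 : ℝ) ^ K)⁻¹ • castZ ξ)) * fc f ξ)
          (ENNReal.ofReal p) (μT n) ≤
        ENNReal.ofReal A * eLpNorm f (ENNReal.ofReal p) (μT n) := by
  obtain ⟨A₀, hA₀, hker⟩ := exists_integral_norm_dyadicBlock_kernel_sq_le (N := n / 2 + 1) hn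
    (by omega)
  set q : ℝ := 2 ^ (-ε) with hq
  have hq0 : 0 < q := Real.rpow_pos_of_pos two_pos _
  have hq1 : q < 1 := Real.rpow_lt_one_of_one_lt_of_neg one_lt_two (by linarith)
  obtain ⟨S, hS0, hS⟩ := exists_sum_comp_pow_succ_le hω_nonneg hω_mono hω_int hq0 hq1
  set w : ℕ → ℝ := fun k => ω (((2 : ℝ) ^ (k - 1)) ^ (-ε)) with hw
  have hw0 : ∀ k, 0 ≤ w k := fun k => hω_nonneg _ (by positivity)
  have hwsum : ∀ K, ∑ k ∈ Finset.range (K + 1), w k ≤ S + ω 1 + ω 1 := by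
    intro K
    calc ∑ k ∈ Finset.range (K + 1), w k ≤ ∑ k ∈ Finset.range (K + 2), w k :=
          Finset.sum_le_sum_of_subset_of_nonneg
            (Finset.range_subset_range.2 (Nat.le_succ _)) fun k _ _ => hw0 k
      _ = ∑ k ∈ Finset.range K, ω (q ^ (k + 1)) + ω 1 + ω 1 := by
          rw [Finset.sum_range_succ', Finset.sum_range_succ']
          congr 1
          · congr 1
            · refine Finset.sum_congr rfl fun k _ => ?_
              simp only [hw, hq]
              congr 1
              rw [← Real.rpow_natCast, ← Real.rpow_natCast, ← Real.rpow_mul zero_le_two,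
                ← Real.rpow_mul zero_le_two, mul_comm]
              simp
            · simp [hw]
          · simp [hw]
      _ ≤ _ := by gcongr; exact hS K
  refine ⟨√A₀ * C * (S + ω 1 + ω 1), fun m hm hmb K p hp f hf => ?_⟩
  have hblock : ∀ k, ∫ x, ‖∑' ξ, dyadicBlock k m ξ * eChar x ξ‖ ∂μT n ≤ √A₀ * C * w k := by
    intro k
    set R : ℝ := 2 ^ (k - 1) with hR
    have hR1 : 1 ≤ R := one_le_pow₀ one_le_two
    have hR0 : 0 < R := by linarith
    have h := hker k m (R ^ ρ) (C * w k * R ^ (-((n : ℝ) / 2) * (1 - ρ))) hm (by positivity)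
      (by simpa using Real.rpow_le_rpow_of_exponent_le hR1 hρ1)
      (mul_nonneg (mul_nonneg hC (hw0 k)) (by positivity)) ?_
    · have e : R ^ n * (C * w k * R ^ (-((n : ℝ) / 2) * (1 - ρ))) ^ 2 * ((R ^ ρ) ^ n)⁻¹ =
          (C * w k) ^ 2 := by
        have : R ^ n * (R ^ (-((n : ℝ) / 2) * (1 - ρ))) ^ 2 * ((R ^ ρ) ^ n)⁻¹ = 1 := by
          rw [← Real.rpow_natCast, ← Real.rpow_natCast, ← Real.rpow_natCast, ← Real.rpow_mul hR0.le,
            ← Real.rpow_mul hR0.le, ← Real.rpow_neg hR0.le, ← Real.rpow_add hR0,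
            ← Real.rpow_add hR0]
          convert Real.rpow_zero R using 2
          push_cast
          ring
        calc _ = (C * w k) ^ 2 *
              (R ^ n * (R ^ (-((n : ℝ) / 2) * (1 - ρ))) ^ 2 * ((R ^ ρ) ^ n)⁻¹) := by ring
          _ = _ := by rw [this, mul_one]
      rw [e] at h
      have h2 : A₀ * (C * w k) ^ 2 = (√A₀ * C * w k) ^ 2 := by
        rw [mul_assoc √A₀, mul_pow √A₀, Real.sq_sqrt hA₀]
      rw [h2] at h
      exact (pow_le_pow_iff_left₀ (integral_nonneg fun _ => norm_nonneg _)
        (mul_nonneg (by positivity) (hw0 k)) two_ne_zero).1 h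
    · intro j i hi ξ hξ
      have hJ0 : 0 < jbR ξ := hR0.trans_le hξ
      have e1 : -((n : ℝ) / 2) * (1 - ρ) - ρ * i ≤ 0 := by
        have h1 : 0 ≤ (n : ℝ) / 2 * (1 - ρ) := mul_nonneg (by positivity) (by linarith)
        have h2 : 0 ≤ ρ * (i : ℝ) := by positivity
        linarith
      calc (R ^ ρ) ^ i * ‖(pd j)^[i] m ξ‖
          ≤ (R ^ ρ) ^ i * (C * w k * R ^ (-((n : ℝ) / 2) * (1 - ρ) - ρ * i)) := by
            gcongr
            refine (hmb j i hi ξ).trans (mul_le_mul (mul_le_mul_of_nonneg_left ?_ hC) ?_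
              (by positivity) (mul_nonneg hC (hw0 k)))
            · refine hω_mono (Set.mem_Ici.2 (by positivity)) (Set.mem_Ici.2 (by positivity)) ?_
              exact Real.rpow_le_rpow_of_nonpos hR0 hξ (by linarith)
            · exact Real.rpow_le_rpow_of_nonpos hR0 hξ e1
        _ = C * w k * ((R ^ ρ) ^ i * R ^ (-((n : ℝ) / 2) * (1 - ρ) - ρ * i)) := by ring
        _ = C * w k * R ^ (-((n : ℝ) / 2) * (1 - ρ)) := by
            rw [← Real.rpow_natCast, ← Real.rpow_mul hR0.le, ← Real.rpow_add hR0]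
            ring_nf
        _ ≤ _ := le_rfl
  have hvan : ∀ k ∈ Finset.range (K + 1), ∀ ξ, ξ ∉ latticeBox n (2 ^ (K + 1)) →
      dyadicBlock k m ξ = 0 := by
    intro k hk ξ hξ
    refine dyadicBlock_eq_zero m fun h => hξ ?_
    refine latticeBox_mono (Nat.pow_le_pow_right two_pos ?_) h
    rw [Finset.mem_range] at hk
    omega
  have hdecomp : (fun x => ∑ ξ ∈ latticeBox n (2 ^ (K + 1)), eChar x ξ *
      (m (castZ ξ) * cutoff n (((2 : ℝ) ^ K)⁻¹ • castZ ξ)) * fc f ξ) =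
      ∑ k ∈ Finset.range (K + 1), fun x => ∑ ξ ∈ latticeBox n (2 ^ (K + 1)),
        eChar x ξ * dyadicBlock k m ξ * fc f ξ := by
    funext x
    rw [Finset.sum_apply, Finset.sum_comm]
    refine Finset.sum_congr rfl fun ξ _ => ?_
    rw [← sum_dyadicBlock, Finset.mul_sum, Finset.sum_mul]
  rw [hdecomp]
  calc _ ≤ ∑ k ∈ Finset.range (K + 1), eLpNorm (fun x => ∑ ξ ∈ latticeBox n (2 ^ (K + 1)),
        eChar x ξ * dyadicBlock k m ξ * fc f ξ) (ENNReal.ofReal p) (μT n) := by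
        refine eLpNorm_sum_le (fun k _ => ?_) (by simpa using hp)
        exact Continuous.aestronglyMeasurable (by fun_prop)
    _ ≤ ∑ k ∈ Finset.range (K + 1),
        ENNReal.ofReal (√A₀ * C * w k) * eLpNorm f (ENNReal.ofReal p) (μT n) :=
        Finset.sum_le_sum fun k hk => eLpNorm_sum_eChar_mul_fc_le (hvan k hk) hp hf (hblock k)
    _ = ENNReal.ofReal (√A₀ * C * ∑ k ∈ Finset.range (K + 1), w k) *
        eLpNorm f (ENNReal.ofReal p) (μT n) := by
        rw [← Finset.sum_mul, Finset.mul_sum, ENNReal.ofReal_sum_of_nonneg]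
        exact fun k _ => mul_nonneg (by positivity) (hw0 k)
    _ ≤ _ := by
        gcongr
        exact hwsum K

/-! ### From frozen symbols to pseudo-differential operators -/

theorem eLpNorm_rpow_eq_lintegral {α : Type*} [MeasurableSpace α] {μ : Measure α} {p : ℝ}
    (hp : 1 ≤ p) (f : α → ℂ) :
    eLpNorm f (ENNReal.ofReal p) μ ^ p = ∫⁻ x, ‖f x‖ₑ ^ p ∂μ := by
  have hp0 : 0 < p := by linarith
  rw [eLpNorm_eq_lintegral_rpow_enorm_toReal (by simpa using hp0) ENNReal.ofReal_ne_top,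
    ENNReal.toReal_ofReal hp0.le, ← ENNReal.rpow_mul, one_div_mul_cancel hp0.ne',
    ENNReal.rpow_one]

/-- If finitely many superpositions `x ↦ ∑ ξ ∈ S, c x ξ * a x₀ ξ`, with `a` any derivative of
order at most `[n/p] + 1` of `b` in `x₀`, are bounded in `L^p` uniformly in `x₀`, then so is the
diagonal superposition. -/
theorem exists_lintegral_diagonal_le (n : ℕ) {p : ℝ} (hp : 1 ≤ p) :
    ∃ A : ℝ≥0∞, A ≠ ⊤ ∧ ∀ {ι : Type} (S : Finset ι) (c : (Fin n → ℝ) → ι → ℂ)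
      (b : ι → (Fin n → ℝ) → ℂ) (Z : ℝ≥0∞), (∀ i, Continuous fun x => c x i) →
      (∀ i, ContDiff ℝ (⊤ : ℕ∞) (b i)) →
      (∀ l : List (Fin n), l.length ≤ ⌊(n : ℝ) / p⌋₊ + 1 → ∀ x₀,
        ∫⁻ x, ‖∑ i ∈ S, c x i * l.foldr pd (b i) x₀‖ₑ ^ p ∂μT n ≤ Z) →
      ∫⁻ x, ‖∑ i ∈ S, c x i * b i x‖ₑ ^ p ∂μT n ≤ A * Z := by
  have hp0 : 0 < p := by linarith
  set k := ⌊(n : ℝ) / p⌋₊ with hk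
  obtain ⟨A, hA, hsob⟩ := enorm_le_sum_eLpNorm_of_contDiff (n := n) hp (k := k)
    (Nat.lt_floor_add_one _)
  set T : Finset (Σ j : ℕ, (Fin j → Fin n)) :=
    (Finset.range (k + 2)).sigma fun j => Finset.univ with hT
  refine ⟨A ^ p * (T.card : ℝ≥0∞) ^ (p - 1) * T.card, ?_, ?_⟩
  · refine ENNReal.mul_ne_top (ENNReal.mul_ne_top (ENNReal.rpow_ne_top_of_nonneg hp0.le hA)
      (ENNReal.rpow_ne_top_of_nonneg (by linarith) (ENNReal.natCast_ne_top _)))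
      (ENNReal.natCast_ne_top _)
  intro ι S c b Z hc hb h
  set G : (Σ j : ℕ, (Fin j → Fin n)) → (Fin n → ℝ) → (Fin n → ℝ) → ℂ := fun t x x₀ =>
    ∑ i ∈ S, c x i * (List.ofFn t.2).foldr pd (b i) x₀ with hG
  have hGc : ∀ t, Continuous (Function.uncurry (G t)) := by
    intro t
    refine continuous_finsetSum _ fun i _ => ?_
    exact ((hc i).comp continuous_fst).mul
      ((contDiff_foldr_pd (List.ofFn t.2) (hb i)).continuous.comp continuous_snd)
  have hpt : ∀ x ∈ cube n, ‖∑ i ∈ S, c x i * b i x‖ₑ ^ p ≤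
      A ^ p * ((T.card : ℝ≥0∞) ^ (p - 1) * ∑ t ∈ T, ∫⁻ x₀, ‖G t x x₀‖ₑ ^ p ∂μT n) := by
    intro x hx
    have h1 := hsob (fun x₀ => ∑ i ∈ S, c x i * b i x₀)
      (ContDiff.sum fun i _ => contDiff_const.mul (hb i)) x hx
    have h2 : ∑ j ∈ Finset.range (k + 2), ∑ s : Fin j → Fin n,
        eLpNorm ((List.ofFn s).foldr pd fun x₀ => ∑ i ∈ S, c x i * b i x₀)
          (ENNReal.ofReal p) (μT n) =
        ∑ t ∈ T, eLpNorm (G t x) (ENNReal.ofReal p) (μT n) := by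
      rw [hT, Finset.sum_sigma]
      refine Finset.sum_congr rfl fun j _ => Finset.sum_congr rfl fun s _ => ?_
      rw [foldr_pd_sum_mul S (c x) (List.ofFn s) hb]
    rw [h2] at h1
    calc _ ≤ (A * ∑ t ∈ T, eLpNorm (G t x) (ENNReal.ofReal p) (μT n)) ^ p :=
          ENNReal.rpow_le_rpow h1 hp0.le
      _ = A ^ p * (∑ t ∈ T, eLpNorm (G t x) (ENNReal.ofReal p) (μT n)) ^ p :=
          ENNReal.mul_rpow_of_nonneg _ _ hp0.le
      _ ≤ _ := by
          gcongr
          refine (ENNReal.rpow_sum_le_const_mul_sum_rpow _ _ hp).trans (le_of_eq ?_)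
          simp only [eLpNorm_rpow_eq_lintegral hp]
  have hGm : ∀ t, Measurable fun x => ∫⁻ x₀, ‖G t x x₀‖ₑ ^ p ∂μT n := fun t =>
    Measurable.lintegral_prod_right ((hGc t).enorm.measurable.pow_const p)
  calc ∫⁻ x, ‖∑ i ∈ S, c x i * b i x‖ₑ ^ p ∂μT n
      ≤ ∫⁻ x, A ^ p * ((T.card : ℝ≥0∞) ^ (p - 1) *
          ∑ t ∈ T, ∫⁻ x₀, ‖G t x x₀‖ₑ ^ p ∂μT n) ∂μT n :=
        lintegral_mono_ae ((ae_restrict_mem (measurableSet_cube n)).mono hpt)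
    _ = A ^ p * ((T.card : ℝ≥0∞) ^ (p - 1) *
          ∑ t ∈ T, ∫⁻ x₀, ∫⁻ x, ‖G t x x₀‖ₑ ^ p ∂μT n ∂μT n) := by
        rw [lintegral_const_mul _ (by fun_prop), lintegral_const_mul _ (by fun_prop),
          lintegral_finsetSum _ fun t _ => hGm t]
        congr 2
        refine Finset.sum_congr rfl fun t _ => ?_
        exact lintegral_lintegral_swap ((hGc t).enorm.measurable.pow_const p).aemeasurable
    _ ≤ A ^ p * ((T.card : ℝ≥0∞) ^ (p - 1) * ∑ _t ∈ T, Z) := by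
        gcongr with t ht
        calc _ ≤ ∫⁻ _x₀, Z ∂μT n := lintegral_mono fun x₀ => h _ (by
              simp only [hT, Finset.mem_sigma, Finset.mem_range] at ht
              simp only [List.length_ofFn]
              omega) x₀
          _ = Z := by simp
    _ = _ := by
        rw [Finset.sum_const, nsmul_eq_mul]
        ring

theorem tendsto_sum_truncated {n : ℕ} {a : (Fin n → ℤ) → ℂ} (ha : Summable a) :
    Filter.Tendsto (fun K : ℕ => ∑ ξ ∈ latticeBox n (2 ^ (K + 1)),
      a ξ * cutoff n (((2 : ℝ) ^ K)⁻¹ • castZ ξ)) Filter.atTop (nhds (∑' ξ, a ξ)) := by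
  have h1 : ∀ K : ℕ, ∑ ξ ∈ latticeBox n (2 ^ (K + 1)),
      a ξ * cutoff n (((2 : ℝ) ^ K)⁻¹ • castZ ξ) =
        ∑' ξ, a ξ * cutoff n (((2 : ℝ) ^ K)⁻¹ • castZ ξ) := fun K => by
    refine (tsum_eq_sum fun ξ hξ => ?_).symm
    have := mul_cutoff_eq_zero (fun _ => 1) hξ
    rw [one_mul] at this
    rw [this, mul_zero]
  simp only [h1]
  refine tendsto_tsum_of_dominated_convergence ha.norm (fun ξ => ?_)
    (Filter.Eventually.of_forall fun K ξ => ?_)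
  · refine tendsto_const_nhds.congr' ?_
    have h2 : ∀ᶠ K : ℕ in Filter.atTop, ‖(castZ ξ : Fin n → ℝ)‖ ≤ (2 : ℝ) ^ K :=
      (tendsto_pow_atTop_atTop_of_one_lt (r := (2 : ℝ)) one_lt_two).eventually_ge_atTop _
    filter_upwards [h2] with K hK
    rw [cutoff_eq_one, mul_one]
    rwa [norm_smul, norm_inv, norm_pow, Real.norm_two, inv_mul_le_iff₀ (by positivity), mul_one]
  · rw [norm_mul]
    exact mul_le_of_le_one_right (norm_nonneg _) (norm_cutoff_le_one _)

theorem lintegral_Op_le {n : ℕ} {p : ℝ} (hp : 1 ≤ p) {σ : (Fin n → ℝ) → (Fin n → ℤ) → ℂ}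
    (hσ : ∀ ξ, Continuous fun x => σ x ξ) (f : (Fin n → ℝ) → ℂ) {Z : ℝ≥0∞}
    (h : ∀ K : ℕ, ∫⁻ x, ‖∑ ξ ∈ latticeBox n (2 ^ (K + 1)),
      eChar x ξ * σ x ξ * fc f ξ * cutoff n (((2 : ℝ) ^ K)⁻¹ • castZ ξ)‖ₑ ^ p ∂μT n ≤ Z) :
    ∫⁻ x, ‖Op σ f x‖ₑ ^ p ∂μT n ≤ Z := by
  have hp0 : 0 < p := by linarith
  set F : ℕ → (Fin n → ℝ) → ℝ≥0∞ := fun K x => ‖∑ ξ ∈ latticeBox n (2 ^ (K + 1)),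
      eChar x ξ * σ x ξ * fc f ξ * cutoff n (((2 : ℝ) ^ K)⁻¹ • castZ ξ)‖ₑ ^ p with hF
  have hpt : ∀ x, ‖Op σ f x‖ₑ ^ p ≤ Filter.liminf (fun K => F K x) Filter.atTop := by
    intro x
    by_cases hs : Summable fun ξ => eChar x ξ * σ x ξ * fc f ξ
    · have := (ENNReal.continuous_rpow_const (y := p)).tendsto _ |>.comp
        (tendsto_sum_truncated hs).enorm
      exact this.liminf_eq.ge
    · rw [Op, tsum_eq_zero_of_not_summable hs, enorm_zero, ENNReal.zero_rpow_of_pos hp0]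
      exact zero_le
  have hFm : ∀ K, Measurable (F K) := by
    intro K
    have : Continuous fun x => ∑ ξ ∈ latticeBox n (2 ^ (K + 1)),
      eChar x ξ * σ x ξ * fc f ξ * cutoff n (((2 : ℝ) ^ K)⁻¹ • castZ ξ) := by fun_prop
    exact this.enorm.measurable.pow_const p
  calc _ ≤ ∫⁻ x, Filter.liminf (fun K => F K x) Filter.atTop ∂μT n := lintegral_mono hpt
    _ ≤ Filter.liminf (fun K => ∫⁻ x, F K x ∂μT n) Filter.atTop := lintegral_liminf_le hFm
    _ ≤ Filter.limsup (fun K => ∫⁻ x, F K x ∂μT n) Filter.atTop := Filter.liminf_le_limsup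
    _ ≤ Z := Filter.limsup_le_of_le (by isBoundedDefault) (Filter.Eventually.of_forall h)

theorem lpT_le_of_lintegral_le {n : ℕ} {p : ℝ} (hp : 1 ≤ p) {f g : (Fin n → ℝ) → ℂ}
    (hf : Continuous f) {B : ℝ≥0∞} (hB : B ≠ ⊤)
    (h : ∫⁻ x, ‖g x‖ₑ ^ p ∂μT n ≤ B * ∫⁻ x, ‖f x‖ₑ ^ p ∂μT n) :
    lpT n p g ≤ B.toReal ^ (1 / p) * lpT n p f := by
  have hp0 : 0 < p := by linarith
  have h_int : ∀ u : (Fin n → ℝ) → ℂ, AEStronglyMeasurable (fun x => ‖u x‖ ^ p) (μT n) →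
      ∫ x, ‖u x‖ ^ p ∂μT n = (∫⁻ x, ‖u x‖ₑ ^ p ∂μT n).toReal := fun u hu => by
    rw [integral_eq_lintegral_of_nonneg_ae
      (Filter.Eventually.of_forall fun x => by positivity) hu]
    congr 2 with x
    rw [← ENNReal.ofReal_rpow_of_nonneg (norm_nonneg _) hp0.le, ofReal_norm]
  have hfp : Continuous fun x => ‖f x‖ ^ p := hf.norm.rpow_const fun _ => Or.inr hp0.le
  have hfin : ∫⁻ x, ‖f x‖ₑ ^ p ∂μT n ≠ ⊤ := by
    have := (Continuous.integrable_μT hfp).2.ne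
    simpa only [← ofReal_norm, Real.norm_of_nonneg (Real.rpow_nonneg (norm_nonneg _) p),
      ← ENNReal.ofReal_rpow_of_nonneg (norm_nonneg _) hp0.le] using this
  have hf0 : 0 ≤ ∫ x, ‖f x‖ ^ p ∂μT n := integral_nonneg fun x => by positivity
  unfold lpT
  rw [← Real.mul_rpow ENNReal.toReal_nonneg hf0]
  refine Real.rpow_le_rpow (integral_nonneg fun x => by positivity) ?_ (by positivity)
  by_cases hg : AEStronglyMeasurable (fun x => ‖g x‖ ^ p) (μT n)
  · rw [h_int g hg, h_int f hfp.aestronglyMeasurable, ← ENNReal.toReal_mul]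
    exact ENNReal.toReal_mono (ENNReal.mul_ne_top hB hfin) h
  · rw [integral_undef fun hi => hg hi.1]
    exact mul_nonneg ENNReal.toReal_nonneg hf0

theorem norm_iterate_pd_foldr_pd_le {n : ℕ} {σ : (Fin n → ℝ) → (Fin n → ℝ) → ℂ}
    (hσ : ContDiff ℝ (⊤ : ℕ∞) fun q : (Fin n → ℝ) × (Fin n → ℝ) => σ q.1 q.2) {M N : ℕ}
    {B : (Fin n → ℝ) → ℝ → ℝ}
    (h : ∀ (α β : Fin n → ℕ), (∑ j, α j) ≤ M → (∑ j, β j) ≤ N → ∀ x ξ,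
      ‖symbDξDx α β σ x ξ‖ ≤ B ξ (∑ j, (α j : ℝ)))
    {l : List (Fin n)} (hl : l.length ≤ N) (x : Fin n → ℝ) (j : Fin n) {i : ℕ} (hi : i ≤ M)
    (ξ : Fin n → ℝ) :
    ‖(pd j)^[i] (fun ξ => l.foldr pd (fun x => σ x ξ) x) ξ‖ ≤ B ξ i := by
  have hs : ∑ k, (Pi.single j i : Fin n → ℕ) k = i := by simp
  have hx : ContDiff ℝ (⊤ : ℕ∞) fun ξ => l.foldr pd (fun x => σ x ξ) x :=
    (contDiff_foldr_pd_left l hσ).comp (contDiff_prodMk_right x)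
  have := h (Pi.single j i) (fun k => l.count k) (hs.trans_le hi)
    ((sum_count_eq_length l).trans_le hl) x ξ
  rw [← Nat.cast_sum, hs, symbDξDx] at this
  rw [← pdM_single j i hx]
  have hxl : ∀ ξ', l.foldr pd (fun x => σ x ξ') = pdM (fun k => l.count k) fun x => σ x ξ' :=
    fun ξ' => foldr_pd_eq_pdM l (hσ.comp (contDiff_prodMk_left ξ'))
  simpa only [hxl] using this

/-- If a smooth symbol `σ : 𝕋ⁿ × ℝⁿ → ℂ` satisfies
`|∂_ξ^α ∂_x^β σ(x,ξ)| ≤ C ω(⟨ξ⟩^{-ε}) ⟨ξ⟩^{-(n/2)(1-ρ) - ρ|α|}` for `|α| ≤ [n/2]+1`,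
`|β| ≤ [n/p]+1`, then the associated periodic pseudo-differential operator is bounded
on `L^p(𝕋ⁿ)`, `1 ≤ p < ∞`. -/
theorem periodic_pseudodiff_smooth_symbol_omega_Lp_bounded
    (n : ℕ) (hn : 1 ≤ n) (ε ρ p : ℝ)
    (hε0 : 0 < ε) (hε1 : ε ≤ 1) (hρ0 : 0 ≤ ρ) (hρ1 : ρ ≤ 1) (hp : 1 ≤ p)
    (ω : ℝ → ℝ) (hω_nonneg : ∀ t, 0 ≤ t → 0 ≤ ω t)
    (hω_mono : MonotoneOn ω (Set.Ici (0 : ℝ)))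
    (hω_bdd : ∃ M : ℝ, ∀ t, 0 ≤ t → ω t ≤ M)
    (hω_int : IntegrableOn (fun t => ω t * t⁻¹) (Set.Ioc (0 : ℝ) 1) volume)
    (σ : (Fin n → ℝ) → (Fin n → ℝ) → ℂ)
    (hσ_smooth : ContDiff ℝ (⊤ : ℕ∞) fun q : (Fin n → ℝ) × (Fin n → ℝ) => σ q.1 q.2)
    (hσ_per : ∀ ξ, Per fun x => σ x ξ)
    (C : ℝ) (hC : 0 < C)
    (hσ : ∀ (α β : Fin n → ℕ), (∑ j, α j) ≤ n / 2 + 1 → (∑ j, β j) ≤ ⌊(n : ℝ) / p⌋₊ + 1 →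
      ∀ (x ξ : Fin n → ℝ),
        ‖symbDξDx α β σ x ξ‖ ≤
          C * ω (jbR ξ ^ (-ε)) * jbR ξ ^ (-((n : ℝ) / 2) * (1 - ρ) - ρ * ∑ j, (α j : ℝ))) :
    ∃ C' : ℝ, 0 < C' ∧ ∀ f : (Fin n → ℝ) → ℂ, ContDiff ℝ (⊤ : ℕ∞) f → Per f →
      lpT n p (Op (fun x ξ => σ x (castZ ξ)) f) ≤ C' * lpT n p f := by
  have hp0 : 0 < p := by linarith
  obtain ⟨A, hA⟩ := exists_eLpNorm_truncated_multiplier_le hn hε0 hρ0 hρ1 hω_nonneg hω_mono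
    hω_int hC.le
  obtain ⟨D, hD, hdiag⟩ := exists_lintegral_diagonal_le n hp
  have hB : D * ENNReal.ofReal A ^ p ≠ ⊤ :=
    ENNReal.mul_ne_top hD (ENNReal.rpow_ne_top_of_nonneg hp0.le ENNReal.ofReal_ne_top)
  have hσ_left : ∀ ξ, ContDiff ℝ (⊤ : ℕ∞) fun x => σ x ξ := fun ξ =>
    hσ_smooth.comp (contDiff_prodMk_left ξ)
  refine ⟨(D * ENNReal.ofReal A ^ p).toReal ^ (1 / p) + 1, by positivity, fun f hf _ => ?_⟩
  have hf0 : 0 ≤ lpT n p f :=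
    Real.rpow_nonneg (integral_nonneg fun x => by positivity) _
  refine (lpT_le_of_lintegral_le hp hf.continuous hB ?_).trans
    (mul_le_mul_of_nonneg_right (by linarith) hf0)
  refine lintegral_Op_le hp (fun ξ => (hσ_left _).continuous) f fun K => ?_
  have key := hdiag (latticeBox n (2 ^ (K + 1)))
    (fun x ξ => eChar x ξ * (cutoff n (((2 : ℝ) ^ K)⁻¹ • castZ ξ) * fc f ξ))
    (fun ξ x => σ x (castZ ξ)) (ENNReal.ofReal A ^ p * ∫⁻ x, ‖f x‖ₑ ^ p ∂μT n)
    (fun ξ => by fun_prop) (fun ξ => hσ_left _) fun l hl x₀ => by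
      have := hA (fun ξ => l.foldr pd (fun x => σ x ξ) x₀)
        ((contDiff_foldr_pd_left l hσ_smooth).comp (contDiff_prodMk_right x₀))
        (fun j i hi ξ => norm_iterate_pd_foldr_pd_le hσ_smooth
          (B := fun ξ s => C * ω (jbR ξ ^ (-ε)) *
            jbR ξ ^ (-((n : ℝ) / 2) * (1 - ρ) - ρ * s)) hσ hl x₀ j hi ξ) K p hp f hf.continuous
      have := ENNReal.rpow_le_rpow this hp0.le
      rw [ENNReal.mul_rpow_of_nonneg _ _ hp0.le, eLpNorm_rpow_eq_lintegral hp,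
        eLpNorm_rpow_eq_lintegral hp] at this
      convert this using 6
      ring
  rw [mul_assoc]
  convert key using 6
  ring
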